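/- arXiv:2409.00672 — 15 statements merged into one kernel-verified Lean document; each statement's English description precedes it below -/
import Mathlib

section
/- Let q ≥ 3. There exists a q-ary orientable sequence of order 2 whose period equals q(q-1)/2 if q is odd, and equals q(q-2)/2 if q is even (these are the maximum possible periods of an OS_q(2)). -/
/-- The window of `n` consecutive terms of the sequence `S` starting at index `i`. -/
def window (q n : ℕ) (S : ℤ → ZMod q) (i : ℤ) : Fin n → ZMod q :=
  fun k => S (i + (k : ℕ))

/-- `S` is a `q`-ary `n`-window sequence of period `m`: it is periodic with period `m`
and no `n`-tuple appears more than once per period. -/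
def IsNWindowSeq (q n m : ℕ) (S : ℤ → ZMod q) : Prop :=
  1 < q ∧ 1 < n ∧ 0 < m ∧ (∀ i : ℤ, S (i + (m : ℕ)) = S i) ∧
    ∀ i j : ℤ, window q n S i = window q n S j → (m : ℤ) ∣ i - j

/-- `S` is an orientable sequence of order `n` (an `OS_q(n)`) with period `m`. -/
def IsOS (q n m : ℕ) (S : ℤ → ZMod q) : Prop :=
  IsNWindowSeq q n m S ∧
    ∀ i j : ℤ, window q n S i ≠ (window q n S j) ∘ Fin.rev

/-- `f 0, f 1, …, f m` is a closed trail of length `m` based at `0` in the complete graph on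
`{0, …, q - 1}`: no edge is traversed twice, in either direction. -/
structure IsClosedTrail (q m : ℕ) (f : ℕ → ℕ) : Prop where
  start : f 0 = 0
  finish : f m = 0
  lt : ∀ i, i ≤ m → f i < q
  inj : ∀ i j, i < m → j < m → f i = f j → f (i + 1) = f (j + 1) → i = j
  oriented : ∀ i j, i < m → j < m → f i = f (j + 1) → f (i + 1) ≠ f j

/-- Two closed trails can be concatenated if every edge of the second one leaves the vertex set
of the first one. -/
theorem IsClosedTrail.append {q q' m n : ℕ} {f g : ℕ → ℕ} (hf : IsClosedTrail q m f)
    (hg : IsClosedTrail q' n g) (hqq : q ≤ q') (hnew : ∀ i, i < n → q ≤ g i ∨ q ≤ g (i + 1)) :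
    IsClosedTrail q' (m + n) (fun i => if i < m then f i else g (i - m)) := by
  have hleft : ∀ i, i ≤ m → (if i < m then f i else g (i - m)) = f i := by
    intro i hi
    split_ifs with h
    · rfl
    · obtain rfl : i = m := by omega
      rw [Nat.sub_self, hg.start, hf.finish]
  have hright : ∀ i, (if m + i < m then f (m + i) else g (m + i - m)) = g i := by
    intro i
    rw [if_neg (by omega), Nat.add_sub_cancel_left]
  have hcase : ∀ i, i < m + n → i < m ∨ ∃ k, k < n ∧ i = m + k := by
    intro i hi
    by_cases h : i < m
    · exact Or.inl h
    · exact Or.inr ⟨i - m, by omega, by omega⟩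
  refine ⟨?_, ?_, ?_, ?_, ?_⟩
  · exact (hleft 0 (Nat.zero_le m)).trans hf.start
  · exact (hright n).trans hg.finish
  · intro i hi
    by_cases h : i < m
    · rw [hleft i h.le]
      exact (hf.lt i h.le).trans_le hqq
    · obtain ⟨k, rfl⟩ := Nat.exists_eq_add_of_le (not_lt.mp h)
      rw [hright k]
      exact hg.lt k (by omega)
  · intro i j hi hj h0 h1
    rcases hcase i hi with hi' | ⟨k, hk, rfl⟩ <;> rcases hcase j hj with hj' | ⟨l, hl, rfl⟩
    · rw [hleft i hi'.le, hleft j hj'.le] at h0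
      rw [hleft (i + 1) hi', hleft (j + 1) hj'] at h1
      exact hf.inj i j hi' hj' h0 h1
    · rw [hleft i hi'.le, hright] at h0
      rw [hleft (i + 1) hi', add_assoc, hright] at h1
      have := hf.lt i hi'.le
      have := hf.lt (i + 1) hi'
      have := hnew l hl
      omega
    · rw [hleft j hj'.le, hright] at h0
      rw [hleft (j + 1) hj', add_assoc, hright] at h1
      have := hf.lt j hj'.le
      have := hf.lt (j + 1) hj'
      have := hnew k hk
      omega
    · rw [hright, hright] at h0
      rw [add_assoc, add_assoc, hright, hright] at h1
      rw [hg.inj k l hk hl h0 h1]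
  · intro i j hi hj h0 h1
    rcases hcase i hi with hi' | ⟨k, hk, rfl⟩ <;> rcases hcase j hj with hj' | ⟨l, hl, rfl⟩
    · rw [hleft i hi'.le, hleft (j + 1) hj'] at h0
      rw [hleft (i + 1) hi', hleft j hj'.le] at h1
      exact hf.oriented i j hi' hj' h0 h1
    · rw [hleft i hi'.le, add_assoc, hright] at h0
      rw [hleft (i + 1) hi', hright] at h1
      have := hf.lt i hi'.le
      have := hf.lt (i + 1) hi'
      have := hnew l hl
      omega
    · rw [hleft (j + 1) hj', hright] at h0
      rw [hleft j hj'.le, add_assoc, hright] at h1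
      have := hf.lt j hj'.le
      have := hf.lt (j + 1) hj'
      have := hnew k hk
      omega
    · rw [add_assoc, hright, hright] at h0
      rw [add_assoc, hright, hright] at h1
      exact hg.oriented k l hk hl h0 h1

/-- The walk `0, q, 1, q + 1, 2, q, 3, q + 1, …, q - 1, …` through the edges joining
`{0, …, q - 1}` to the two new vertices `q` and `q + 1`. It is closed up by `q + 1, 0` if `q` is
even and by `q, q + 1, 0` if `q` is odd. -/
def zigzag (q k : ℕ) : ℕ :=
  if 2 * q ≤ k then (if k = 2 * q ∧ q % 2 = 1 then q + 1 else 0)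
  else if k % 2 = 0 then k / 2
  else if k % 4 = 1 then q
  else q + 1

theorem isClosedTrail_zigzag {q : ℕ} (hq : 0 < q) :
    IsClosedTrail (q + 2) (2 * q + q % 2) (zigzag q) := by
  refine ⟨?_, ?_, ?_, ?_, ?_⟩
  · unfold zigzag
    split_ifs <;> omega
  · unfold zigzag
    split_ifs <;> omega
  · intro i hi
    unfold zigzag
    split_ifs <;> omega
  · intro i j hi hj
    unfold zigzag
    grind
  · intro i j hi hj
    unfold zigzag
    grind

theorem zigzag_new {q i : ℕ} (hi : i < 2 * q + q % 2) :
    q ≤ zigzag q i ∨ q ≤ zigzag q (i + 1) := by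
  unfold zigzag
  split_ifs <;> omega

theorem IsClosedTrail.exists_extend {q m : ℕ} (hq : 0 < q) (h : ∃ f, IsClosedTrail q m f) :
    ∃ f, IsClosedTrail (q + 2) (m + (2 * q + q % 2)) f :=
  let ⟨_, hf⟩ := h
  ⟨_, hf.append (isClosedTrail_zigzag hq) (by omega) fun _ => zigzag_new⟩

theorem exists_isClosedTrail_zero {q : ℕ} (hq : 0 < q) : ∃ f, IsClosedTrail q 0 f :=
  ⟨fun _ => 0, rfl, rfl, fun _ _ => hq, by simp, by simp⟩

theorem exists_isClosedTrail_odd (t : ℕ) :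
    ∃ f, IsClosedTrail (2 * t + 1) ((2 * t + 1) * t) f := by
  induction t with
  | zero => exact exists_isClosedTrail_zero Nat.one_pos
  | succ t ih =>
    have h := IsClosedTrail.exists_extend (by omega) ih
    rwa [show (2 * t + 1) * t + (2 * (2 * t + 1) + (2 * t + 1) % 2) =
      (2 * (t + 1) + 1) * (t + 1) by rw [show (2 * t + 1) % 2 = 1 by omega]; ring] at h

theorem exists_isClosedTrail_even (t : ℕ) :
    ∃ f, IsClosedTrail (2 * t + 2) ((2 * t + 2) * t) f := by
  induction t with
  | zero => exact exists_isClosedTrail_zero Nat.two_pos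
  | succ t ih =>
    have h := IsClosedTrail.exists_extend (by omega) ih
    rwa [show (2 * t + 2) * t + (2 * (2 * t + 2) + (2 * t + 2) % 2) =
      (2 * (t + 1) + 2) * (t + 1) by rw [show (2 * t + 2) % 2 = 0 by omega]; ring] at h

theorem IsClosedTrail.exists_isOS {q m : ℕ} {f : ℕ → ℕ} (hf : IsClosedTrail q m f)
    (hq : 1 < q) (hm : 0 < m) : ∃ S, IsOS q 2 m S := by
  have hm' : (0 : ℤ) < m := by exact_mod_cast hm
  have hlt : ∀ i : ℤ, (i % m).toNat < m := by
    intro i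
    have := Int.emod_lt_of_pos i hm'
    have := Int.emod_nonneg i hm'.ne'
    omega
  have hsucc : ∀ i : ℤ, f ((i + 1) % m).toNat = f ((i % m).toNat + 1) := by
    intro i
    have h1 := Int.emod_lt_of_pos i hm'
    have h2 := Int.emod_nonneg i hm'.ne'
    rw [← Int.emod_add_emod]
    rcases (show i % m + 1 < m ∨ i % m + 1 = m by omega) with h | h
    · rw [Int.emod_eq_of_lt (by omega) h]
      congr 1
      omega
    · rw [h, Int.emod_self, show (i % m).toNat + 1 = m by omega, hf.finish]
      exact hf.start
  have hcast : ∀ a b, a ≤ m → b ≤ m → (f a : ZMod q) = f b → f a = f b := by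
    intro a b ha hb h
    rw [ZMod.natCast_eq_natCast_iff'] at h
    rwa [Nat.mod_eq_of_lt (hf.lt a ha), Nat.mod_eq_of_lt (hf.lt b hb)] at h
  refine ⟨fun i => (f (i % m).toNat : ZMod q), ⟨hq, Nat.one_lt_two, hm, ?_, ?_⟩, ?_⟩
  · intro i
    simp
  · intro i j h
    have h0 := congrFun h 0
    have h1 := congrFun h 1
    simp only [window, Fin.val_zero, Fin.val_one, Nat.cast_zero, Nat.cast_one, add_zero,
      hsucc] at h0 h1
    have h2 := hf.inj _ _ (hlt i) (hlt j) (hcast _ _ (hlt i).le (hlt j).le h0)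
      (hcast _ _ (hlt i) (hlt j) h1)
    have := Int.emod_nonneg i hm'.ne'
    have := Int.emod_nonneg j hm'.ne'
    exact (Int.ModEq.dvd (show j % m = i % m by omega))
  · intro i j h
    have h0 := congrFun h 0
    have h1 := congrFun h 1
    have r0 : Fin.rev (0 : Fin 2) = 1 := rfl
    have r1 : Fin.rev (1 : Fin 2) = 0 := rfl
    simp only [window, Function.comp_apply, r0, r1, Fin.val_zero, Fin.val_one, Nat.cast_zero,
      Nat.cast_one, add_zero, hsucc] at h0 h1
    exact hf.oriented _ _ (hlt i) (hlt j) (hcast _ _ (hlt i).le (hlt j) h0)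
      (hcast _ _ (hlt i) (hlt j).le h1)

/-- For `q ≥ 3` there exists a `q`-ary orientable sequence of order 2 with
period `q(q-1)/2` if `q` is odd and `q(q-2)/2` if `q` is even. -/
theorem stmt0 (q : ℕ) (hq : 3 ≤ q) :
    ∃ (m : ℕ) (S : ℤ → ZMod q), IsOS q 2 m S ∧
      m = (if Odd q then q * (q - 1) / 2 else q * (q - 2) / 2) := by
  rcases Nat.even_or_odd' q with ⟨t, ht | ht⟩
  · obtain ⟨t, rfl⟩ : ∃ k, t = k + 1 := ⟨t - 1, by omega⟩
    obtain rfl : q = 2 * t + 2 := ht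
    obtain ⟨f, hf⟩ := exists_isClosedTrail_even t
    obtain ⟨S, hS⟩ := hf.exists_isOS (by omega) (Nat.mul_pos (by omega) (by omega))
    refine ⟨_, S, hS, ?_⟩
    rw [if_neg (by rw [Nat.odd_iff]; omega), Nat.add_sub_cancel,
      Nat.mul_div_assoc _ (dvd_mul_right 2 t), Nat.mul_div_cancel_left t Nat.two_pos]
  · subst ht
    obtain ⟨f, hf⟩ := exists_isClosedTrail_odd t
    obtain ⟨S, hS⟩ := hf.exists_isOS (by omega) (Nat.mul_pos (by omega) (by omega))
    refine ⟨_, S, hS, ?_⟩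
    rw [if_pos (odd_two_mul_add_one t), Nat.add_sub_cancel,
      Nat.mul_div_assoc _ (dvd_mul_right 2 t), Nat.mul_div_cancel_left t Nat.two_pos]
end

section
/- For n ≥ 2 and q ≥ 2, the period of any q-ary negative orientable sequence of order n is at most (q^n - q^{n/2})/2 if n is even; at most (q^n - q^{(n-1)/2})/2 if n is odd and q is odd; and at most (q^n - 2·q^{(n-1)/2})/2 if n is odd and q is even. -/
/-- `S` is a negative orientable sequence of order `n` (an `NOS_q(n)`) with period `m`. -/
def IsNOS (q n m : ℕ) (S : ℤ → ZMod q) : Prop :=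
  IsNWindowSeq q n m S ∧
    ∀ i j : ℤ, window q n S i ≠ -((window q n S j) ∘ Fin.rev)

/-- Negated reversal of an `n`-tuple. -/
def negRev {q n : ℕ} (u : Fin n → ZMod q) : Fin n → ZMod q :=
  -(u ∘ Fin.rev)

theorem negRev_involutive {q n : ℕ} : Function.Involutive (negRev (q := q) (n := n)) := by
  intro u
  ext k
  simp [negRev]

/-- The points of an orbit disjoint from its image under an involution, their images, and the fixed
points of the involution are pairwise distinct. -/
theorem Function.Involutive.two_mul_card_add_card_le {α ι β : Type*} [Fintype α] [Fintype ι]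
    [Fintype β] {σ : α → α} (hσ : Function.Involutive σ) {w : ι → α} (hw : Function.Injective w)
    (hne : ∀ i j, w i ≠ σ (w j)) {g : β → α} (hg : Function.Injective g)
    (hfix : ∀ b, σ (g b) = g b) :
    2 * Fintype.card ι + Fintype.card β ≤ Fintype.card α := by
  have hwg : ∀ i b, w i ≠ g b := by
    intro i b h
    apply hne i i
    rw [h, hfix]
  have hinj : Function.Injective (Sum.elim (Sum.elim w (σ ∘ w)) g) := by
    refine (hw.sumElim (hσ.injective.comp hw) hne).sumElim hg ?_
    rintro (i | i) b h
    · exact hwg i b h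
    · apply hwg i b
      apply hσ.injective
      rw [hfix]
      exact h
  have := Fintype.card_le_of_injective _ hinj
  simp only [Fintype.card_sum] at this
  omega

/-- The tuple of length `n` with first half `f`, middle entry `c` (if `n` is odd) and second half
the negated reversal of `f`. -/
def negPalindrome {q : ℕ} (n : ℕ) (f : Fin (n / 2) → ZMod q) (c : ZMod q) : Fin n → ZMod q :=
  fun i => if h : (i : ℕ) < n / 2 then f ⟨i, h⟩
    else if h : n - 1 - (i : ℕ) < n / 2 then -f ⟨n - 1 - i, h⟩ else c

theorem negRev_negPalindrome {q n : ℕ} (f : Fin (n / 2) → ZMod q) {c : ZMod q} (hc : -c = c) :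
    negRev (negPalindrome n f c) = negPalindrome n f c := by
  ext i
  have hi := i.isLt
  have hrev : (i.rev : ℕ) = n - 1 - i := by rw [Fin.val_rev]; omega
  have hsub : n - 1 - (n - 1 - (i : ℕ)) = i := by omega
  simp only [negRev, negPalindrome, Pi.neg_apply, Function.comp_apply, hrev, hsub]
  split_ifs
  · omega
  all_goals simp [hc]

theorem negPalindrome_left_injective {q n : ℕ} {f f' : Fin (n / 2) → ZMod q} {c c' : ZMod q}
    (h : negPalindrome n f c = negPalindrome n f' c') : f = f' := by
  ext k
  have hk := k.isLt
  have := congrFun h ⟨k, by omega⟩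
  simpa [negPalindrome] using this

theorem negPalindrome_middle_injective {q n : ℕ} (hn : Odd n) {f f' : Fin (n / 2) → ZMod q}
    {c c' : ZMod q} (h : negPalindrome n f c = negPalindrome n f' c') : c = c' := by
  obtain ⟨t, rfl⟩ := hn
  have := congrFun h ⟨t, by omega⟩
  have h1 : ¬ t < (2 * t + 1) / 2 := by omega
  have h2 : ¬ 2 * t + 1 - 1 - t < (2 * t + 1) / 2 := by omega
  simpa only [negPalindrome, h1, h2, dite_false] using this

theorem IsNWindowSeq.window_injective {q n m : ℕ} {S : ℤ → ZMod q} (hS : IsNWindowSeq q n m S) :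
    Function.Injective fun i : Fin m => window q n S (i : ℕ) := by
  intro i j hij
  have hdvd := hS.2.2.2.2 _ _ hij
  have hi := i.isLt
  have hj := j.isLt
  have := Int.eq_zero_of_abs_lt_dvd hdvd (by rw [abs_lt]; omega)
  ext
  omega

/-- Twice the period plus any number of tuples fixed by negated reversal is at most `q ^ n`. -/
theorem IsNOS.two_mul_add_card_le {q n m : ℕ} {S : ℤ → ZMod q} (hS : IsNOS q n m S)
    {β : Type*} [Fintype β] {g : β → Fin n → ZMod q} (hg : Function.Injective g)
    (hfix : ∀ b, negRev (g b) = g b) : 2 * m + Fintype.card β ≤ q ^ n := by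
  have : NeZero q := ⟨by have := hS.1.1; omega⟩
  simpa [ZMod.card] using negRev_involutive.two_mul_card_add_card_le
    hS.1.window_injective (fun i j => hS.2 _ _) hg hfix

theorem IsNOS.two_mul_add_pow_le {q n m : ℕ} {S : ℤ → ZMod q} (hS : IsNOS q n m S) :
    2 * m + q ^ (n / 2) ≤ q ^ n := by
  have : NeZero q := ⟨by have := hS.1.1; omega⟩
  simpa [ZMod.card] using hS.two_mul_add_card_le
    (g := fun f : Fin (n / 2) → ZMod q => negPalindrome n f 0)
    (fun _ _ h => negPalindrome_left_injective h) (fun f => negRev_negPalindrome f neg_zero)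

theorem IsNOS.two_mul_add_two_mul_pow_le {q n m : ℕ} {S : ℤ → ZMod q} (hS : IsNOS q n m S)
    (hn : Odd n) (hq : Even q) : 2 * m + 2 * q ^ (n / 2) ≤ q ^ n := by
  have hq1 := hS.1.1
  have : NeZero q := ⟨by omega⟩
  obtain ⟨r, hr⟩ := hq
  have hr0 : (r : ZMod q) ≠ 0 := by
    rw [Ne, ZMod.natCast_eq_zero_iff]
    intro h
    have := Nat.le_of_dvd (by omega) h
    omega
  have hrr : -(r : ZMod q) = r := by
    rw [neg_eq_iff_add_eq_zero, ← Nat.cast_add, ← hr, ZMod.natCast_self]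
  have h := hS.two_mul_add_card_le
    (g := fun p : Bool × (Fin (n / 2) → ZMod q) =>
      negPalindrome n p.2 (if p.1 then (r : ZMod q) else 0))
    (by
      rintro ⟨b, f⟩ ⟨b', f'⟩ h
      have hf : f = f' := negPalindrome_left_injective h
      have hb := negPalindrome_middle_injective hn h
      cases b <;> cases b' <;> simp_all)
    (by
      rintro ⟨b, f⟩
      apply negRev_negPalindrome
      cases b <;> simp [hrr])
  simpa [ZMod.card] using h

/-- bound on the period of a negative orientable sequence. -/
theorem stmt2 (q n m : ℕ) (hn : 2 ≤ n) (hq : 2 ≤ q) (S : ℤ → ZMod q)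
    (hS : IsNOS q n m S) :
    (m : ℚ) ≤ (if Even n then ((q : ℚ) ^ n - (q : ℚ) ^ (n / 2)) / 2
      else if Odd q then ((q : ℚ) ^ n - (q : ℚ) ^ ((n - 1) / 2)) / 2
      else ((q : ℚ) ^ n - 2 * (q : ℚ) ^ ((n - 1) / 2)) / 2) := by
  have h1 : (2 * m + q ^ (n / 2) : ℚ) ≤ q ^ n := mod_cast hS.two_mul_add_pow_le
  split_ifs with hne hqo
  · linarith
  · obtain ⟨t, rfl⟩ := Nat.not_even_iff_odd.mp hne
    rw [show (2 * t + 1 - 1) / 2 = (2 * t + 1) / 2 by omega]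
    linarith
  · have hno := Nat.not_even_iff_odd.mp hne
    have h2 : (2 * m + 2 * q ^ (n / 2) : ℚ) ≤ q ^ n :=
      mod_cast hS.two_mul_add_two_mul_pow_le hno (Nat.not_odd_iff_even.mp hqo)
    obtain ⟨t, rfl⟩ := hno
    rw [show (2 * t + 1 - 1) / 2 = (2 * t + 1) / 2 by omega]
    linarith
end

section
/- Suppose n ≥ 2 and u=(u_0,...,u_{n-1}) is a q-ary n-tuple that is both negasymmetric and (n-1)-negasymmetric. Then u is c-uniform for some c ∈ Z_q satisfying c = -c, i.e. c = 0, or c = q/2 when q is even. -/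
/-- an `n`-tuple that is negasymmetric and `(n-1)`-negasymmetric is
`c`-uniform for some `c` with `c = -c`. -/
theorem stmt3 (q n : ℕ) (hn : 2 ≤ n) (u : Fin n → ZMod q)
    (hnega : ∀ i : Fin n, u i = - u i.rev)
    (hnega' : ∀ i j : Fin n, (i : ℕ) + (j : ℕ) = n - 2 → u i = - u j) :
    ∃ c : ZMod q, c = -c ∧ ∀ i, u i = c := by
  have hsucc (i : ℕ) (hi : i + 1 < n) : u ⟨i + 1, hi⟩ = u ⟨i, by omega⟩ := by
    have hrev : (⟨i + 1, hi⟩ : Fin n).rev = ⟨n - 2 - i, by omega⟩ := by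
      ext
      simp only [Fin.val_rev]
      omega
    rw [hnega ⟨i + 1, hi⟩, hrev]
    exact (hnega' ⟨i, by omega⟩ ⟨n - 2 - i, by omega⟩ (by simp only; omega)).symm
  have hconst (i : ℕ) (hi : i < n) : u ⟨i, hi⟩ = u ⟨0, by omega⟩ := by
    induction i with
    | zero => rfl
    | succ i ih => exact (hsucc i hi).trans (ih (by omega))
  refine ⟨u ⟨0, by omega⟩, ?_, fun i => hconst i i.isLt⟩
  have hrev := hconst _ (Fin.rev ⟨0, by omega⟩ : Fin n).isLt
  exact (hnega _).trans (congrArg Neg.neg hrev)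
end

section
/- Suppose n ≥ 2, S=(s_i) is a q-ary negative orientable sequence of order n, and v=(v_0,...,v_{n-2}) is a negasymmetric q-ary (n-1)-tuple. Let L*_S(v) be the set of q-ary n-tuples u whose first n-1 entries are v_0,...,v_{n-2} and which appear (as a window of n consecutive terms) in S or in -S^R. Then |L*_S(v)| is even. -/
theorem window_neg_reverse (q n : ℕ) (S : ℤ → ZMod q) (j : ℤ) :
    window q n (fun t => -S (-t)) j = -(window q n S (1 - n - j) ∘ Fin.rev) := by
  funext k
  simp only [window, Pi.neg_apply, Function.comp_apply, Fin.val_rev]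
  congr 2
  have := k.isLt
  push_cast [Nat.cast_sub (show (k : ℕ) + 1 ≤ n from this)]
  ring

theorem window_emod (q n m : ℕ) (S : ℤ → ZMod q) (hper : ∀ i : ℤ, S (i + (m : ℕ)) = S i)
    (i : ℤ) : window q n S (i % m) = window q n S i := by
  have hp : Function.Periodic S (m : ℤ) := hper
  funext k
  have h := hp.sub_zsmul_eq (x := i + (k : ℕ)) (i / m)
  simp only [window]
  rw [← h, Int.emod_def, smul_eq_mul]
  congr 1
  ring

/-- An `n`-tuple `-w^R` extends a negasymmetric `(n-1)`-tuple `v` iff `w` ends with `v`. -/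
theorem neg_reverse_window_extends_iff (q n : ℕ) (S : ℤ → ZMod q) (v : Fin (n - 1) → ZMod q)
    (hv : ∀ i, v i = -v i.rev) (i : ℤ) :
    (∀ k : Fin (n - 1),
      (-(window q n S (i - 1) ∘ Fin.rev)) (Fin.castLE (Nat.sub_le n 1) k) = v k) ↔
      window q (n - 1) S i = v := by
  have key (k : Fin (n - 1)) :
      (-(window q n S (i - 1) ∘ Fin.rev)) (Fin.castLE (Nat.sub_le n 1) k) =
        -window q (n - 1) S i k.rev := by
    simp only [window, Pi.neg_apply, Function.comp_apply, Fin.val_rev, Fin.val_castLE]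
    congr 2
    have := k.isLt
    omega
  simp only [key]
  constructor
  · intro h
    funext k
    rw [hv k, ← h k.rev, Fin.rev_rev, neg_neg]
  · rintro rfl k
    exact (hv k).symm

/-- if `v` is a negasymmetric `(n-1)`-tuple then the number of `n`-tuples
extending `v` that appear in `S` or in `-S^R` is even. -/
theorem stmt4 (q n m : ℕ) (hn : 2 ≤ n) (hq : 2 ≤ q) (S : ℤ → ZMod q)
    (hS : IsNOS q n m S) (v : Fin (n - 1) → ZMod q)
    (hv : ∀ i : Fin (n - 1), v i = - v i.rev) :
    Even (Nat.card {u : Fin n → ZMod q //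
      (∀ i : Fin (n - 1), u (Fin.castLE (Nat.sub_le n 1) i) = v i) ∧
      (∃ j : ℤ, window q n S j = u ∨ window q n (fun t => - S (-t)) j = u)}) := by
  classical
  obtain ⟨⟨-, -, hm, hper, hinj⟩, hori⟩ := hS
  have hm' : (m : ℤ) ≠ 0 := by exact_mod_cast hm.ne'
  let F : Finset ℤ := (Finset.Ico (0 : ℤ) m).filter fun i => window q (n - 1) S i = v
  let f : ℤ → Fin n → ZMod q := window q n S
  let g : ℤ → Fin n → ZMod q := fun i => -(window q n S (i - 1) ∘ Fin.rev)
  have hF : ∀ i, i ∈ F ↔ (0 ≤ i ∧ i < m) ∧ window q (n - 1) S i = v := by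
    simp [F]
  have hmod : ∀ i, window q (n - 1) S i = v → i % m ∈ F := fun i hi =>
    (hF _).2 ⟨⟨Int.emod_nonneg _ hm', Int.emod_lt_of_pos _ (by exact_mod_cast hm)⟩,
      (window_emod q (n - 1) m S hper i).trans hi⟩
  have hFeq : ∀ i ∈ F, ∀ j ∈ F, (m : ℤ) ∣ i - j → i = j := by
    intro i hi j hj h
    obtain ⟨⟨hi0, him⟩, -⟩ := (hF i).1 hi
    obtain ⟨⟨hj0, hjm⟩, -⟩ := (hF j).1 hj
    rw [← Int.emod_eq_of_lt hi0 him, ← Int.emod_eq_of_lt hj0 hjm]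
    exact Int.emod_eq_emod_iff_emod_sub_eq_zero.2 (Int.emod_eq_zero_of_dvd h)
  have hf : Set.InjOn f F := fun i hi j hj h => hFeq i hi j hj (hinj i j h)
  have hg : Set.InjOn g F := by
    intro i hi j hj h
    have h' := Fin.rev_surjective.injective_comp_right (neg_injective h)
    simpa using hFeq i hi j hj (by simpa using hinj _ _ h')
  have hdisj : Disjoint (F.image f) (F.image g) := by
    simp only [Finset.disjoint_left, Finset.mem_image]
    rintro _ ⟨i, -, rfl⟩ ⟨j, -, h⟩
    exact hori i (j - 1) h.symm
  have hgmod : ∀ i, g (i % m) = g i := by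
    intro i
    have h : window q n S (i % m - 1) = window q n S (i - 1) := by
      rw [← window_emod q n m S hper (i % m - 1), Int.emod_sub_emod,
        window_emod q n m S hper]
    simp only [g, h]
  have hcard : Nat.card {u : Fin n → ZMod q //
      (∀ i : Fin (n - 1), u (Fin.castLE (Nat.sub_le n 1) i) = v i) ∧
      (∃ j : ℤ, window q n S j = u ∨ window q n (fun t => - S (-t)) j = u)} =
      (F.image f ∪ F.image g).card := by
    refine Nat.subtype_card _ fun u => ?_
    simp only [Finset.mem_union, Finset.mem_image]
    constructor
    · rintro (⟨i, hi, rfl⟩ | ⟨i, hi, rfl⟩)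
      · exact ⟨fun k => congrFun ((hF i).1 hi).2 k, i, Or.inl rfl⟩
      · refine ⟨(neg_reverse_window_extends_iff q n S v hv i).2 ((hF i).1 hi).2,
          2 - n - i, Or.inr ?_⟩
        rw [window_neg_reverse, show (1 - n - (2 - n - i) : ℤ) = i - 1 by ring]
    · rintro ⟨hu, j, rfl | rfl⟩
      · exact Or.inl ⟨j % m, hmod j (funext hu), window_emod q n m S hper j⟩
      · have hj : window q n (fun t => -S (-t)) j = g (2 - n - j) := by
          rw [window_neg_reverse, show (1 - n - j : ℤ) = 2 - n - j - 1 by ring]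
        rw [hj] at hu ⊢
        exact Or.inr ⟨_, hmod _ ((neg_reverse_window_extends_iff q n S v hv _).1 hu), hgmod _⟩
  rw [hcard, Finset.card_union_of_disjoint hdisj, Finset.card_image_of_injOn hf,
    Finset.card_image_of_injOn hg]
  exact ⟨_, rfl⟩
end

section
/- Let q ≥ 3. There exists a q-ary negative orientable sequence of order 2 whose period equals q(q-1)/2 if q is odd, and equals q(q-1)/2 - 1 if q is even (these are the maximum possible periods of an NOS_q(2)). -/
/-- The list of cyclically consecutive pairs of the closed walk `l`. -/
def cyclicPairs {V : Type*} (l : List V) : List (V × V) := l.zip (l.rotate 1)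

lemma length_cyclicPairs {V : Type*} (l : List V) : (cyclicPairs l).length = l.length := by
  simp [cyclicPairs]

lemma cyclicPairs_rotate {V : Type*} (l : List V) (n : ℕ) :
    cyclicPairs (l.rotate n) = (cyclicPairs l).rotate n := by
  have := List.zipWith_rotate_distrib Prod.mk l (l.rotate 1) n (by simp)
  simp only [cyclicPairs, List.zip]
  rw [this, List.rotate_rotate, List.rotate_rotate, Nat.add_comm]

/-- A closed walk through `a` can be rotated so that it starts at `a`. -/
lemma exists_cons_perm_cyclicPairs {V : Type*} {l : List V} {a : V} (ha : a ∈ l) :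
    ∃ t : List V, (a :: t).length = l.length ∧ (∀ x, x ∈ a :: t ↔ x ∈ l) ∧
      (cyclicPairs (a :: t)).Perm (cyclicPairs l) := by
  obtain ⟨s, t, rfl⟩ := List.append_of_mem ha
  refine ⟨t ++ s, by simp; omega, fun x => by simp; tauto, ?_⟩
  have h : (s ++ a :: t).rotate s.length = a :: (t ++ s) := by
    simp [List.rotate_append_length_eq]
  rw [← h, cyclicPairs_rotate]
  exact List.rotate_perm _ _

lemma fst_mem_of_mem_cyclicPairs {V : Type*} {l : List V} {p : V × V}
    (hp : p ∈ cyclicPairs l) : p.1 ∈ l :=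
  (List.of_mem_zip (a := p.1) (b := p.2) hp).1

/-- A finite symmetric relation that is connected around a loop at `r` has a closed walk
traversing each of its ordered pairs exactly once. -/
lemma exists_closed_walk {V : Type*} [Fintype V] [DecidableEq V] (R : V → V → Prop)
    (symm : ∀ a b, R a b → R b a) (r : V) (hr : R r r)
    (conn : ∀ C : Set V, r ∈ C → (∀ a b, a ∈ C → R a b → b ∈ C) → ∀ a, a ∈ C) :
    ∃ l : List V, l ≠ [] ∧ (cyclicPairs l).Nodup ∧
      ∀ a b, (a, b) ∈ cyclicPairs l ↔ R a b := by
  let P : List V → Prop := fun l => r ∈ l ∧ (cyclicPairs l).Nodup ∧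
    (∀ a b, (a, b) ∈ cyclicPairs l → R a b) ∧
    (∀ a b, (a, b) ∈ cyclicPairs l → (b, a) ∈ cyclicPairs l)
  have hbound : ∀ l, P l → l.length ≤ Fintype.card (V × V) := by
    intro l hl
    rw [← length_cyclicPairs]
    exact hl.2.1.length_le_card
  have hex : ∃ n, ∃ l, P l ∧ l.length = n := by
    refine ⟨1, [r], ⟨by simp, by simp [cyclicPairs], ?_, ?_⟩, rfl⟩
    · simpa [cyclicPairs] using hr
    · simp [cyclicPairs]
  obtain ⟨l, hl, hmax⟩ : ∃ l, P l ∧ ∀ l', P l' → l'.length ≤ l.length := by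
    classical
    obtain ⟨n₀, l₀, hl₀, hn₀⟩ := hex
    have hs := Nat.findGreatest_spec (P := fun n => ∃ l, P l ∧ l.length = n)
      (hn₀ ▸ hbound l₀ hl₀) ⟨l₀, hl₀, hn₀⟩
    obtain ⟨l, hl, hn⟩ := hs
    exact ⟨l, hl, fun l' hl' => hn ▸ Nat.le_findGreatest (hbound l' hl') ⟨l', hl', rfl⟩⟩
  obtain ⟨hrl, hnd, hsub, hsw⟩ := hl
  have hfull : ∀ a b, a ∈ l → R a b → (a, b) ∈ cyclicPairs l := by
    intro a b ha hab
    by_contra hnot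
    have hnot' : (b, a) ∉ cyclicPairs l := fun h => hnot (hsw _ _ h)
    obtain ⟨t, hlen, hmem, hperm⟩ := exists_cons_perm_cyclicPairs ha
    have hmp : ∀ p, p ∈ cyclicPairs (a :: t) ↔ p ∈ cyclicPairs l := fun p => hperm.mem_iff
    have hnd' := hperm.nodup_iff.2 hnd
    by_cases heq : a = b
    · subst heq
      have he : cyclicPairs (a :: a :: t) = (a, a) :: cyclicPairs (a :: t) := by
        simp [cyclicPairs]
      have := hmax (a :: a :: t) ⟨by have := (hmem r).2 hrl; simp_all, ?_, ?_, ?_⟩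
      · simp at this hlen; omega
      · rw [he, List.nodup_cons, hmp]; exact ⟨hnot, hnd'⟩
      · intro x y h
        rw [he, List.mem_cons, hmp] at h
        rcases h with h | h
        · cases h; exact hab
        · exact hsub _ _ h
      · intro x y h
        rw [he, List.mem_cons, hmp] at h ⊢
        rcases h with h | h
        · cases h; exact Or.inl rfl
        · exact Or.inr (hsw _ _ h)
    · have he : cyclicPairs (a :: b :: a :: t) = (a, b) :: (b, a) :: cyclicPairs (a :: t) := by
        simp [cyclicPairs]
      have := hmax (a :: b :: a :: t) ⟨by have := (hmem r).2 hrl; simp at this ⊢; tauto, ?_, ?_, ?_⟩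
      · simp at this hlen; omega
      · rw [he, List.nodup_cons, List.nodup_cons, List.mem_cons, hmp, hmp]
        refine ⟨?_, hnot', hnd'⟩
        rintro (h | h)
        · exact heq (Prod.mk.inj h).1
        · exact hnot h
      · intro x y h
        rw [he, List.mem_cons, List.mem_cons, hmp] at h
        rcases h with h | h | h
        · cases h; exact hab
        · cases h; exact symm _ _ hab
        · exact hsub _ _ h
      · intro x y h
        rw [he, List.mem_cons, List.mem_cons, hmp] at h ⊢
        rcases h with h | h | h
        · cases h; exact Or.inr (Or.inl rfl)
        · cases h; exact Or.inl rfl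
        · exact Or.inr (Or.inr (hsw _ _ h))
  have hall := conn {a | a ∈ l} hrl
    fun a b ha hab => fst_mem_of_mem_cyclicPairs (hsw _ _ (hfull a b ha hab))
  exact ⟨l, List.ne_nil_of_mem hrl, hnd,
    fun a b => ⟨hsub a b, hfull a b (hall a)⟩⟩

/-- A closed walk whose consecutive pairs are distinct and closed under no negated reversal
yields a negative orientable sequence of order 2. -/
lemma exists_isNOS_of_cyclicPairs {q : ℕ} (hq : 1 < q) (l : List (ZMod q)) (hl : l ≠ [])
    (hnd : (cyclicPairs l).Nodup)
    (hneg : ∀ a b, (a, b) ∈ cyclicPairs l → (-b, -a) ∉ cyclicPairs l) :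
    ∃ S : ℤ → ZMod q, IsNOS q 2 l.length S := by
  have hm : 0 < l.length := List.length_pos_iff.2 hl
  have hm' : (0 : ℤ) < l.length := by exact_mod_cast hm
  let c : ℤ → ℕ := fun i => (i % (l.length : ℤ)).toNat
  have hcz : ∀ i, (c i : ℤ) = i % l.length := fun i =>
    Int.toNat_of_nonneg (Int.emod_nonneg _ hm'.ne')
  have hc : ∀ i, c i < l.length := fun i => by
    have := Int.emod_lt_of_pos i hm'
    have := hcz i
    omega
  have hcs : ∀ i, c (i + 1) = (c i + 1) % l.length := fun i => by
    zify
    rw [hcz, hcz, Int.emod_add_emod]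
  let S : ℤ → ZMod q := fun i => l[c i]'(hc i)
  have hS : ∀ i, (cyclicPairs l)[c i]'(by rw [length_cyclicPairs]; exact hc i)
      = (S i, S (i + 1)) := by
    intro i
    simp [cyclicPairs, S, List.getElem_rotate, hcs]
  have hmem : ∀ i, (S i, S (i + 1)) ∈ cyclicPairs l := fun i => by
    rw [← hS]; exact List.getElem_mem _
  refine ⟨S, ⟨hq, by norm_num, hm, ?_, ?_⟩, ?_⟩
  · intro i
    have : c (i + (l.length : ℕ)) = c i := by simp [c]
    simp [S, this]
  · intro i j h
    have h0 : S i = S j := by simpa [window] using congrFun h 0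
    have h1 : S (i + 1) = S (j + 1) := by simpa [window] using congrFun h 1
    have h2 := (hS i).trans ((by rw [h0, h1] : (S i, S (i + 1)) = _).trans (hS j).symm)
    have h3 := (hnd.getElem_inj_iff).1 h2
    have h4 : i % (l.length : ℤ) = j % l.length := by rw [← hcz, ← hcz, h3]
    exact Int.ModEq.dvd (Eq.symm h4)
  · intro i j h
    have h0 : S i = -S (j + 1) := by simpa [window, Fin.rev] using congrFun h 0
    have h1 : S (i + 1) = -S j := by simpa [window, Fin.rev] using congrFun h 1
    refine hneg _ _ (hmem j) ?_
    rw [← h0, ← h1]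
    exact hmem i

/-- The pairs with sum in the lower half of `ZMod q`; when the sum is exactly `q / 2`, the
first entry has to lie strictly in the lower half. -/
def HalfSum (q : ℕ) (a b : ZMod q) : Prop :=
  (0 < 2 * (a + b).val ∧ 2 * (a + b).val < q) ∨
    (2 * (a + b).val = q ∧ 0 < 2 * a.val ∧ 2 * a.val < q)

lemma ZMod.val_add_eq_or {q : ℕ} [NeZero q] (a b : ZMod q) :
    a.val + b.val = (a + b).val ∨ a.val + b.val = (a + b).val + q := by
  rcases lt_or_ge (a.val + b.val) q with h | h
  · left; exact (ZMod.val_add_of_lt h).symm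
  · right; exact (ZMod.val_add_val_of_le h)

lemma HalfSum.symm {q : ℕ} [NeZero q] {a b : ZMod q} (h : HalfSum q a b) : HalfSum q b a := by
  have := ZMod.val_add_eq_or a b
  have := b.val_lt
  have := a.val_lt
  unfold HalfSum at *
  rw [add_comm b a]
  omega

lemma ZMod.val_add_val_neg {q : ℕ} [NeZero q] (a : ZMod q) :
    (a.val = 0 ∧ (-a).val = 0) ∨ (a.val ≠ 0 ∧ a.val + (-a).val = q) := by
  have := ZMod.val_add_eq_or a (-a)
  have := (-a).val_lt
  have := a.val_lt
  rw [add_neg_cancel, ZMod.val_zero] at *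
  omega

lemma HalfSum.not_neg {q : ℕ} [NeZero q] {a b : ZMod q} (h : HalfSum q a b) :
    ¬ HalfSum q (-b) (-a) := by
  have := ZMod.val_add_eq_or a b
  have := b.val_lt
  have := a.val_lt
  have := ZMod.val_add_val_neg (a + b)
  have := ZMod.val_add_val_neg b
  unfold HalfSum at *
  rw [show -b + -a = -(a + b) by ring]
  omega

lemma not_halfSum_iff {q : ℕ} [NeZero q] (a b : ZMod q) :
    (¬ HalfSum q a b ∧ ¬ HalfSum q (-b) (-a)) ↔
      a + b = 0 ∨ (a.val = 0 ∧ 2 * b.val = q) ∨ (2 * a.val = q ∧ b.val = 0) := by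
  have := ZMod.val_add_eq_or a b
  have := b.val_lt
  have := a.val_lt
  have := ZMod.val_add_val_neg (a + b)
  have := ZMod.val_add_val_neg b
  have := (a + b).val_lt
  rw [← ZMod.val_eq_zero]
  unfold HalfSum at *
  rw [show -b + -a = -(a + b) by ring]
  omega

open Classical in
lemma two_mul_card_halfSum (q : ℕ) [NeZero q] :
    2 * (Finset.univ.filter fun p : ZMod q × ZMod q => HalfSum q p.1 p.2).card + q
      + (if Odd q then 0 else 2) = q * q := by
  set E := Finset.univ.filter fun p : ZMod q × ZMod q => HalfSum q p.1 p.2 with hE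
  set E' := Finset.univ.filter fun p : ZMod q × ZMod q => HalfSum q (-p.2) (-p.1) with hE'
  set Z := Finset.univ.filter fun p : ZMod q × ZMod q => p.1 + p.2 = 0 with hZ
  set X := Finset.univ.filter fun p : ZMod q × ZMod q =>
    (p.1.val = 0 ∧ 2 * p.2.val = q) ∨ (2 * p.1.val = q ∧ p.2.val = 0) with hX
  have hq : 0 < q := NeZero.pos q
  have hEE' : E'.card = E.card := by
    refine Finset.card_bij' (fun p _ => (-p.2, -p.1)) (fun p _ => (-p.2, -p.1)) ?_ ?_ ?_ ?_ <;>
      simp [hE, hE']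
  have hZc : Z.card = q := by
    have : Z = Finset.univ.image fun a : ZMod q => (a, -a) := by
      ext ⟨a, b⟩
      simp [hZ, add_eq_zero_iff_eq_neg', eq_comm]
    rw [this, Finset.card_image_of_injective _ (fun a b h => (Prod.mk.inj h).1),
      Finset.card_univ, ZMod.card]
  have hXc : X.card = if Odd q then 0 else 2 := by
    split_ifs with ho
    · rw [Finset.card_eq_zero, Finset.filter_eq_empty_iff]
      rintro p -
      have := Nat.odd_iff.1 ho
      omega
    · obtain ⟨h, hh⟩ := Nat.not_odd_iff_even.1 ho
      have hv : ∀ a : ZMod q, 2 * a.val = q ↔ a = (h : ZMod q) := by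
        intro a
        rw [← (ZMod.val_injective q).eq_iff, ZMod.val_natCast, Nat.mod_eq_of_lt (by omega)]
        omega
      have : X = {(0, (h : ZMod q)), ((h : ZMod q), 0)} := by
        ext ⟨a, b⟩
        simp [hX, hv]
      rw [this, Finset.card_pair]
      intro he
      have := (hv 0).2 (Prod.mk.inj he).1
      rw [ZMod.val_zero] at this
      omega
  have d1 : Disjoint E E' := by
    rw [Finset.disjoint_filter]
    exact fun p _ h => h.not_neg
  have d2 : Disjoint Z X := by
    rw [Finset.disjoint_filter]
    intro p _ h h'
    have := ZMod.val_add_eq_or p.1 p.2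
    rw [h, ZMod.val_zero] at this
    omega
  have hcompl : (E ∪ E')ᶜ = Z ∪ X := by
    ext p
    simp only [hE, hE', hZ, hX, Finset.mem_compl, Finset.mem_union, Finset.mem_filter,
      Finset.mem_univ, true_and, not_or]
    exact not_halfSum_iff p.1 p.2
  have := Finset.card_add_card_compl (E ∪ E')
  rw [hcompl, Finset.card_union_of_disjoint d1, Finset.card_union_of_disjoint d2, hEE', hZc, hXc,
    Fintype.card_prod, ZMod.card] at this
  omega

lemma exists_isNOS_of_five_le (q : ℕ) (hq : 5 ≤ q) :
    ∃ (m : ℕ) (S : ℤ → ZMod q), IsNOS q 2 m S ∧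
      m = (if Odd q then q * (q - 1) / 2 else q * (q - 1) / 2 - 1) := by
  classical
  have : NeZero q := ⟨by omega⟩
  have v1 : (1 : ZMod q).val = 1 := by
    simpa [Nat.mod_eq_of_lt (by omega : 1 < q)] using ZMod.val_natCast q 1
  have v2 : (2 : ZMod q).val = 2 := by
    simpa [Nat.mod_eq_of_lt (by omega : 2 < q)] using ZMod.val_natCast q 2
  have hsum1 : ∀ a b : ZMod q, a + b = 1 → HalfSum q a b := fun a b h => by
    left; rw [h, v1]; omega
  have hsum2 : ∀ a b : ZMod q, a + b = 2 → HalfSum q a b := fun a b h => by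
    left; rw [h, v2]; omega
  obtain ⟨l, hl, hnd, hmem⟩ := exists_closed_walk (HalfSum q) (fun a b h => h.symm) 1
    (hsum2 _ _ (by norm_num)) (by
      intro C h1 hC a
      have hstep : ∀ c ∈ C, c + 1 ∈ C := fun c hc =>
        hC (1 - c) _ (hC c _ hc (hsum1 _ _ (by ring))) (hsum2 _ _ (by ring))
      have hnat : ∀ n : ℕ, (1 + n : ZMod q) ∈ C := by
        intro n
        induction n with
        | zero => simpa using h1
        | succ n ih => simpa [add_assoc] using hstep _ ih
      have := hnat (a - 1).val
      rwa [ZMod.natCast_zmod_val, add_sub_cancel] at this)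
  obtain ⟨S, hS⟩ := exists_isNOS_of_cyclicPairs (by omega) l hl hnd fun a b h h' =>
    ((hmem _ _).1 h).not_neg ((hmem _ _).1 h')
  refine ⟨l.length, S, hS, ?_⟩
  have hcard : l.length
      = (Finset.univ.filter fun p : ZMod q × ZMod q => HalfSum q p.1 p.2).card := by
    rw [← length_cyclicPairs, ← List.toFinset_card_of_nodup hnd]
    congr 1
    ext ⟨a, b⟩
    simp [hmem]
  have := two_mul_card_halfSum q
  rw [← hcard] at this
  rw [Nat.mul_sub_one]
  split_ifs at this ⊢ <;> omega

/-- for `q ≥ 3` there exists a maximal `NOS_q(2)`, of period `q(q-1)/2`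
if `q` is odd, and `q(q-1)/2 - 1` if `q` is even. -/
theorem stmt6 (q : ℕ) (hq : 3 ≤ q) :
    ∃ (m : ℕ) (S : ℤ → ZMod q), IsNOS q 2 m S ∧
      m = (if Odd q then q * (q - 1) / 2 else q * (q - 1) / 2 - 1) := by
  rcases (by omega : q = 3 ∨ q = 4 ∨ 5 ≤ q) with rfl | rfl | h
  · obtain ⟨S, hS⟩ := exists_isNOS_of_cyclicPairs (q := 3) (by norm_num) [0, 1, 1]
      (by simp) (by decide) (by decide)
    exact ⟨_, S, hS, by decide⟩
  · obtain ⟨S, hS⟩ := exists_isNOS_of_cyclicPairs (q := 4) (by norm_num) [0, 1, 1, 2, 1]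
      (by simp) (by decide) (by decide)
    exact ⟨_, S, hS, by decide⟩
  · exact exists_isNOS_of_five_le q h
end

section
/- Suppose n ≥ 2 and S is a q-ary n-window sequence with the property that every n-tuple of consecutive terms appearing in S has pseudoweight strictly less than nq/2. Then S is a negative orientable sequence of order n. -/
/-- The pseudoweight of a `q`-ary `n`-tuple: entry `u` counts as `u` (in `[0,q-1]`)
if nonzero, and as `q/2` if zero. -/
def pweight (q n : ℕ) (u : Fin n → ZMod q) : ℚ :=
  ∑ i, if u i = 0 then (q : ℚ) / 2 else ((u i).val : ℚ)

/-- `r_{q,n,s}`: the number of `q`-ary `n`-tuples with pseudoweight exactly `s`. -/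
noncomputable def rcount (q n : ℕ) (s : ℚ) : ℕ :=
  Nat.card {u : Fin n → ZMod q // pweight q n u = s}

/-- The pseudoweight does not change when the tuple is reversed. -/
theorem pweight_comp_rev (q n : ℕ) (u : Fin n → ZMod q) :
    pweight q n (u ∘ Fin.rev) = pweight q n u :=
  Equiv.sum_comp Fin.revPerm fun i => if u i = 0 then (q : ℚ) / 2 else ((u i).val : ℚ)

/-- The pseudoweights of a tuple and of its negative add up to `n * q`. -/
theorem pweight_add_pweight_neg (q n : ℕ) [NeZero q] (u : Fin n → ZMod q) :
    pweight q n u + pweight q n (-u) = n * q := by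
  have hterm (i : Fin n) : (if u i = 0 then (q : ℚ) / 2 else ((u i).val : ℚ)) +
      (if (-u) i = 0 then (q : ℚ) / 2 else (((-u) i).val : ℚ)) = q := by
    by_cases h : u i = 0
    · simp [h]
    · simp [h, ZMod.neg_val, Nat.cast_sub (ZMod.val_lt (u i)).le]
  simp_rw [pweight, ← Finset.sum_add_distrib, hterm]
  simp

/-- an `n`-window sequence all of whose `n`-tuples have pseudoweight
less than `nq/2` is a negative orientable sequence of order `n`. -/
theorem stmt7 (q n m : ℕ) (hn : 2 ≤ n) (S : ℤ → ZMod q)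
    (hwin : IsNWindowSeq q n m S)
    (hpw : ∀ i : ℤ, pweight q n (window q n S i) < (n : ℚ) * q / 2) :
    IsNOS q n m S := by
  refine ⟨hwin, fun i j h => ?_⟩
  have : NeZero q := ⟨by have := hwin.1; omega⟩
  have hsum := pweight_add_pweight_neg q n (window q n S j ∘ Fin.rev)
  rw [pweight_comp_rev, ← h] at hsum
  linarith [hpw i, hpw j]
end

section
/- For all q > 2 and n ≥ 2, there exists a q-ary negative orientable sequence of order n whose period equals (q^n - r_{q,n,nq/2})/2, where r_{q,n,s} denotes the number of q-ary n-tuples with pseudoweight exactly s. -/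
/-- Composing a permutation with a transposition of two points in different cycles puts these
points in the same cycle. -/
theorem Equiv.Perm.sameCycle_mul_swap_self {X : Type*} [Finite X] [DecidableEq X]
    {σ : Equiv.Perm X} {v w : X} (h : ¬ σ.SameCycle v w) : (σ * Equiv.swap v w).SameCycle w v := by
  by_contra hc
  have key : ∀ j : ℕ, (σ * Equiv.swap v w).SameCycle w ((σ ^ (j + 1)) v) := by
    intro j
    induction j with
    | zero => exact ⟨1, by simp⟩
    | succ j ih =>
      have hv : (σ ^ (j + 1)) v ≠ v := fun e => hc (by rwa [e] at ih)
      have hw : (σ ^ (j + 1)) v ≠ w := fun e => h ⟨(j + 1 : ℕ), by rw [zpow_natCast]; exact e⟩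
      refine ih.trans ⟨1, ?_⟩
      rw [zpow_one, Equiv.Perm.mul_apply, Equiv.swap_apply_of_ne_of_ne hv hw, pow_succ' σ (j + 1),
        Equiv.Perm.mul_apply]
  have h1 := key (orderOf σ - 1)
  rw [Nat.sub_add_cancel (orderOf_pos σ), pow_orderOf_eq_one] at h1
  exact hc h1

/-- Composing a permutation with a transposition of two points in different cycles merges
cycles without splitting any. -/
theorem Equiv.Perm.SameCycle.mul_swap {X : Type*} [Finite X] [DecidableEq X]
    {σ : Equiv.Perm X} {v w x y : X} (h : ¬ σ.SameCycle v w) (hxy : σ.SameCycle x y) :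
    (σ * Equiv.swap v w).SameCycle x y := by
  have hwv := Equiv.Perm.sameCycle_mul_swap_self h
  have step : ∀ z, (σ * Equiv.swap v w).SameCycle z (σ z) := by
    intro z
    by_cases hv : z = v
    · subst hv
      exact hwv.symm.trans ⟨1, by simp⟩
    by_cases hw : z = w
    · subst hw
      exact hwv.trans ⟨1, by simp⟩
    · exact ⟨1, by simp [Equiv.swap_apply_of_ne_of_ne hv hw]⟩
  obtain ⟨j, rfl⟩ := hxy.exists_nat_pow_eq
  induction j with
  | zero => exact Equiv.Perm.SameCycle.refl _ _
  | succ j ih =>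
    rw [pow_succ', Equiv.Perm.mul_apply]
    exact (ih ⟨j, by simp⟩).trans (step _)

/-- Cycle joining, an Eulerian circuit criterion: the elements of `X` are the edges of a digraph
with source map `p` and target map `s`. If some permutation sends each edge to a consecutive one
and every edge has a walk to `x₀`, then there is such a permutation with only one cycle. -/
theorem exists_perm_sameCycle {X Y : Type*} [Finite X] (p s : X → Y) (σ₀ : Equiv.Perm X)
    (h₀ : ∀ x, p (σ₀ x) = s x) (T : X → X) (hT : ∀ x, p (T x) = s x) (x₀ : X)
    (hx₀ : ∀ x, ∃ j : ℕ, T^[j] x = x₀) :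
    ∃ σ : Equiv.Perm X, (∀ x, p (σ x) = s x) ∧ ∀ x, σ.SameCycle x₀ x := by
  classical
  obtain ⟨σ, hσ, hmax⟩ := Set.exists_max_image {σ : Equiv.Perm X | ∀ x, p (σ x) = s x}
    (fun σ => Set.ncard {x | σ.SameCycle x₀ x}) (Set.toFinite _) ⟨σ₀, h₀⟩
  refine ⟨σ, hσ, ?_⟩
  have closed : ∀ v, σ.SameCycle x₀ (T v) → σ.SameCycle x₀ v := by
    intro v hv
    by_contra hnv
    set w := σ⁻¹ (T v) with hw
    have hσw : σ w = T v := by simp [hw]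
    have hx₀w : σ.SameCycle x₀ w := hv.trans ⟨-1, by simp [hw]⟩
    have hvw : ¬ σ.SameCycle v w := fun h => hnv (hx₀w.trans h.symm)
    have hs : s w = s v := by rw [← hσ, hσw, hT]
    refine absurd (hmax (σ * Equiv.swap v w) fun x => ?_) (not_le.mpr ?_)
    · rw [Equiv.Perm.mul_apply, hσ, Equiv.swap_apply_def]
      split_ifs with h1 h2
      · rw [h1, hs]
      · rw [h2, hs]
      · rfl
    · refine Set.ncard_lt_ncard ⟨fun x hx => Equiv.Perm.SameCycle.mul_swap hvw hx, fun hsub => ?_⟩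
        (Set.toFinite _)
      exact hnv (hsub ((Equiv.Perm.SameCycle.mul_swap hvw hx₀w).trans
        (Equiv.Perm.sameCycle_mul_swap_self hvw)))
  intro x
  obtain ⟨j, hj⟩ := hx₀ x
  induction j generalizing x with
  | zero => exact hj ▸ Equiv.Perm.SameCycle.refl _ _
  | succ j ih => exact closed x (ih (T x) hj)

/-- The contribution of a single letter to the pseudoweight. -/
def letterWeight (q : ℕ) (a : ZMod q) : ℚ :=
  if a = 0 then (q : ℚ) / 2 else (a.val : ℚ)

theorem pweight_eq_sum (q n : ℕ) (u : Fin n → ZMod q) :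
    pweight q n u = ∑ i, letterWeight q (u i) := rfl

theorem letterWeight_one {q : ℕ} (hq : 2 < q) : letterWeight q 1 = 1 := by
  have : Fact (1 < q) := ⟨by omega⟩
  simp [letterWeight, ZMod.val_one]

theorem one_le_letterWeight {q : ℕ} (hq : 2 < q) (a : ZMod q) : 1 ≤ letterWeight q a := by
  unfold letterWeight
  split_ifs with h
  · have : (2 : ℚ) < q := by exact_mod_cast hq
    linarith
  · have := (ZMod.val_ne_zero a).mpr h
    exact_mod_cast Nat.one_le_iff_ne_zero.mpr this

theorem letterWeight_neg {q : ℕ} [NeZero q] (a : ZMod q) :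
    letterWeight q (-a) = q - letterWeight q a := by
  unfold letterWeight
  by_cases h : a = 0
  · simp only [h, neg_zero, if_true]
    ring
  · have hlt := (ZMod.val_lt a).le
    simp only [neg_eq_zero, h, if_false, ZMod.neg_val, Nat.cast_sub hlt]

theorem pweight_neg {q n : ℕ} [NeZero q] (u : Fin n → ZMod q) :
    pweight q n (-u) = n * q - pweight q n u := by
  simp [pweight_eq_sum, letterWeight_neg]

theorem pweight_comp_equiv {q n : ℕ} (e : Equiv.Perm (Fin n)) (u : Fin n → ZMod q) :
    pweight q n (u ∘ e) = pweight q n u :=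
  Equiv.sum_comp e fun i => letterWeight q (u i)

theorem pweight_snoc_tail_one_le {q n : ℕ} (hq : 2 < q) (u : Fin (n + 1) → ZMod q) :
    pweight q (n + 1) (Fin.snoc (α := fun _ => ZMod q) (Fin.tail u) 1) ≤ pweight q (n + 1) u := by
  rw [pweight_eq_sum, pweight_eq_sum, Fin.sum_univ_castSucc, Fin.sum_univ_succ]
  simp only [Fin.snoc_castSucc, Fin.snoc_last, Fin.tail, letterWeight_one hq]
  linarith [one_le_letterWeight hq (u 0)]

/-- The `q`-ary `n`-tuples of pseudoweight less than `nq/2`. -/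
abbrev LightTuple (q n : ℕ) : Type :=
  {u : Fin n → ZMod q // pweight q n u < n * q / 2}

theorem card_lightTuple (q n : ℕ) [NeZero q] :
    q ^ n = 2 * Nat.card (LightTuple q n) + rcount q n (n * q / 2) := by
  classical
  have hgt : Nat.card {u : Fin n → ZMod q // (n * q / 2 : ℚ) < pweight q n u} =
      Nat.card (LightTuple q n) :=
    Nat.card_congr ((Equiv.neg _).subtypeEquiv fun u => by
      rw [Equiv.neg_apply, pweight_neg]
      constructor <;> intro h <;> linarith)
  have htot : Nat.card (Fin n → ZMod q) = q ^ n := by simp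
  rw [← htot, ← Nat.card_congr (Equiv.sumCompl fun u => pweight q n u < (n * q / 2 : ℚ)),
    Nat.card_sum, two_mul, add_assoc]
  congr 1
  rw [← hgt, rcount, ← Nat.card_congr (Equiv.sumCompl fun u :
    {u : Fin n → ZMod q // ¬ pweight q n u < (n * q / 2 : ℚ)} => (n * q / 2 : ℚ) < pweight q n u),
    Nat.card_sum]
  congr 1
  · exact Nat.card_congr (Equiv.subtypeSubtypeEquivSubtype fun h => not_lt.mpr (le_of_lt h))
  · exact Nat.card_congr ((Equiv.subtypeSubtypeEquivSubtypeInter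
      (fun u => ¬ pweight q n u < (n * q / 2 : ℚ))
      (fun u => ¬ (n * q / 2 : ℚ) < pweight q n u)).trans
      (Equiv.subtypeEquivRight fun u => by rw [not_lt, not_lt, and_comm, ← le_antisymm_iff]))

/-- The all-ones tuple, as a light tuple. -/
def onesTuple {q : ℕ} (hq : 2 < q) (n : ℕ) : LightTuple q (n + 1) :=
  ⟨fun _ => 1, by
    have : (2 : ℚ) < q := by exact_mod_cast hq
    have hn : (0 : ℚ) < (n + 1 : ℕ) := by positivity
    simp only [pweight_eq_sum, letterWeight_one hq, Finset.sum_const, Finset.card_univ,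
      Fintype.card_fin, nsmul_eq_mul, mul_one]
    nlinarith⟩

/-- Shift a light tuple to the left, appending the letter `1`. -/
def shiftOne {q n : ℕ} (hq : 2 < q) (u : LightTuple q (n + 1)) : LightTuple q (n + 1) :=
  ⟨Fin.snoc (α := fun _ => ZMod q) (Fin.tail u.1) 1,
    (pweight_snoc_tail_one_le hq u.1).trans_lt u.2⟩

theorem iterate_shiftOne_apply {q n : ℕ} (hq : 2 < q) (u : LightTuple q (n + 1)) (j : ℕ)
    (k : Fin (n + 1)) (h : n < k + j) : ((shiftOne hq)^[j] u).1 k = 1 := by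
  induction j generalizing k with
  | zero => omega
  | succ j ih =>
    rw [Function.iterate_succ_apply']
    induction k using Fin.lastCases with
    | last => exact Fin.snoc_last (α := fun _ => ZMod q) _ _
    | cast k =>
      refine (Fin.snoc_castSucc (α := fun _ => ZMod q) _ _ _).trans (ih k.succ ?_)
      simp only [Fin.val_castSucc, Fin.val_succ] at h ⊢
      omega

/-- There is a single-cycle permutation of the light tuples sending each tuple to one that
overlaps it. -/
theorem exists_perm_lightTuple {q : ℕ} [NeZero q] (hq : 2 < q) (n : ℕ) :
    ∃ σ : Equiv.Perm (LightTuple q (n + 1)), (∀ u, Fin.init (σ u).1 = Fin.tail u.1) ∧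
      ∀ u, σ.SameCycle (onesTuple hq n) u := by
  have rot (u : Fin (n + 1) → ZMod q) :
      (finRotate (n + 1)).symm.arrowCongr (Equiv.refl (ZMod q)) u = u ∘ finRotate (n + 1) := rfl
  refine exists_perm_sameCycle (fun u => Fin.init u.1) (fun u => Fin.tail u.1)
    (((finRotate (n + 1)).symm.arrowCongr (Equiv.refl (ZMod q))).subtypeEquiv fun u => by
      rw [rot, pweight_comp_equiv]) (fun u => ?_) (shiftOne hq) (fun u => ?_) _
    fun u => ⟨n + 1, Subtype.ext <| funext fun k => iterate_shiftOne_apply hq u _ k (by omega)⟩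
  · funext k
    simp [rot, Fin.init, Fin.tail]
  · exact Fin.init_snoc (α := fun _ => ZMod q) _ _

/-- The windows of the sequence of first letters along an orbit of overlapping light tuples are
the tuples of that orbit. -/
theorem window_of_overlap {q n : ℕ} (σ : Equiv.Perm (LightTuple q (n + 1)))
    (hσ : ∀ u, Fin.init (σ u).1 = Fin.tail u.1) (u : LightTuple q (n + 1)) (i : ℤ) :
    window q (n + 1) (fun i => ((σ ^ i) u).1 0) i = ((σ ^ i) u).1 := by
  funext k
  change ((σ ^ (i + (k : ℕ))) u).1 0 = _
  induction k using Fin.induction generalizing i with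
  | zero => simp
  | succ k ih =>
    have h1 : i + ((k.succ : ℕ) : ℤ) = (i + 1) + ((k.castSucc : ℕ) : ℤ) := by
      simp only [Fin.val_succ, Fin.val_castSucc]
      push_cast
      ring
    rw [h1, ih, add_comm i 1, zpow_one_add, Equiv.Perm.mul_apply]
    exact congrFun (hσ _) k

/-- there exists an `NOS_q(n)` of period `(q^n - r_{q,n,nq/2})/2`. -/
theorem stmt8 (q n : ℕ) (hq : 2 < q) (hn : 2 ≤ n) :
    ∃ (m : ℕ) (S : ℤ → ZMod q), IsNOS q n m S ∧
      (m : ℚ) = ((q : ℚ) ^ n - rcount q n ((n : ℚ) * q / 2)) / 2 := by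
  classical
  have : NeZero q := ⟨by omega⟩
  obtain ⟨n, rfl⟩ : ∃ k, n = k + 1 := ⟨n - 1, by omega⟩
  obtain ⟨σ, hσ, hcyc⟩ := exists_perm_lightTuple hq n
  have := Fintype.ofFinite (LightTuple q (n + 1))
  have hcard : (Finset.univ : Finset (LightTuple q (n + 1))).card =
      Nat.card (LightTuple q (n + 1)) := by rw [Finset.card_univ, Nat.card_eq_fintype_card]
  have hon : σ.IsCycleOn (Finset.univ : Finset (LightTuple q (n + 1))) :=
    ⟨by simp, fun x _ y _ => (hcyc x).symm.trans (hcyc y)⟩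
  have hwin := window_of_overlap σ hσ (onesTuple hq n)
  refine ⟨Nat.card (LightTuple q (n + 1)), fun i => ((σ ^ i) (onesTuple hq n)).1 0,
    ⟨⟨by omega, by omega, ?_, fun i => ?_, fun i j h => ?_⟩, fun i j h => ?_⟩, ?_⟩
  · exact Nat.card_pos_iff.mpr ⟨⟨onesTuple hq n⟩, inferInstance⟩
  · beta_reduce
    rw [zpow_add, Equiv.Perm.mul_apply, zpow_natCast, ← hcard,
      hon.pow_card_apply (Finset.mem_univ _)]
  · rw [hwin, hwin] at h
    rw [← hcard, ← hon.zpow_apply_eq (Finset.mem_univ (onesTuple hq n)), sub_eq_neg_add, zpow_add,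
      Equiv.Perm.mul_apply, Subtype.ext h, ← Equiv.Perm.mul_apply, ← zpow_add]
    simp
  · rw [hwin, hwin] at h
    have h1 := congrArg (pweight q (n + 1)) h
    rw [pweight_neg, show (Fin.rev : Fin (n + 1) → _) = Fin.revPerm from rfl, pweight_comp_equiv] at h1
    linarith [((σ ^ i) (onesTuple hq n)).2, ((σ ^ j) (onesTuple hq n)).2]
  · have h : (q : ℚ) ^ (n + 1) = 2 * Nat.card (LightTuple q (n + 1)) +
        rcount q (n + 1) ((n + 1 : ℕ) * q / 2) := by
      exact_mod_cast card_lightTuple q (n + 1)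
    rw [h]
    ring
end

section
/- Let q ≥ 3 be odd. Then r_{q,2,q} = q, and for every w with 2 ≤ w ≤ 2q-2 and w ≠ q, r_{q,2,w} < q. -/
theorem pweight_two_eq_natCast_iff {q : ℕ} (hodd : Odd q) (u : Fin 2 → ZMod q) (w : ℕ) :
    pweight q 2 u = (w : ℚ) ↔
      (u 0 = 0 ∧ u 1 = 0 ∧ w = q) ∨
        (u 0 ≠ 0 ∧ u 1 ≠ 0 ∧ (u 0).val + (u 1).val = w) := by
  have half_add_ne (a : ℕ) : (q : ℚ) / 2 + a ≠ w := by
    intro h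
    have h' : q + 2 * a = 2 * w := by
      have : (q : ℚ) + 2 * a = 2 * w := by linarith
      exact_mod_cast this
    obtain ⟨k, rfl⟩ := hodd
    omega
  rw [pweight, Fin.sum_univ_two]
  by_cases h0 : u 0 = 0 <;> by_cases h1 : u 1 = 0
  · simp only [h0, h1, if_true, add_halves, true_and, ne_eq, not_true, false_and, or_false]
    rw [Nat.cast_inj, eq_comm]
  · simpa [h0, h1] using half_add_ne (u 1).val
  · simpa [h0, h1, add_comm] using half_add_ne (u 0).val
  · simp only [h0, h1, if_false, false_and, ne_eq, not_false_eq_true, true_and, false_or]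
    exact_mod_cast Iff.rfl

theorem pweight_two_eq_self_iff {q : ℕ} [NeZero q] (hodd : Odd q) (u : Fin 2 → ZMod q) :
    pweight q 2 u = (q : ℚ) ↔ u 1 = -u 0 := by
  rw [pweight_two_eq_natCast_iff hodd]
  by_cases h0 : u 0 = 0
  · simp [h0]
  · have : NeZero (u 0) := ⟨h0⟩
    have hval := ZMod.val_neg_of_ne_zero (u 0)
    have hlt := ZMod.val_lt (u 0)
    constructor
    · rintro (⟨h, -⟩ | ⟨-, -, h⟩)
      · exact absurd h h0
      · apply ZMod.val_injective q
        omega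
    · intro h
      refine Or.inr ⟨h0, by simpa [h] using h0, ?_⟩
      rw [h]
      omega

theorem rcount_two_self {q : ℕ} [NeZero q] (hodd : Odd q) : rcount q 2 (q : ℚ) = q := by
  have hbij : Function.Bijective
      (fun u : {u : Fin 2 → ZMod q // pweight q 2 u = (q : ℚ)} => u.1 0) := by
    constructor
    · rintro ⟨u, hu⟩ ⟨v, hv⟩ (h : u 0 = v 0)
      rw [pweight_two_eq_self_iff hodd] at hu hv
      refine Subtype.ext (funext (Fin.forall_fin_two.2 ⟨h, ?_⟩))
      change u 1 = v 1
      rw [hu, hv, h]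
    · intro x
      exact ⟨⟨![x, -x], (pweight_two_eq_self_iff hodd _).2 rfl⟩, rfl⟩
  rw [rcount, Nat.card_eq_of_bijective _ hbij, Nat.card_zmod]

theorem rcount_two_lt {q : ℕ} [NeZero q] (hodd : Odd q) {w : ℕ} (hw : w ≠ q) :
    rcount q 2 (w : ℚ) < q := by
  have key (u : Fin 2 → ZMod q) (hu : pweight q 2 u = (w : ℚ)) :
      u 0 ≠ 0 ∧ (u 0).val + (u 1).val = w := by
    rcases (pweight_two_eq_natCast_iff hodd u w).1 hu with ⟨-, -, h⟩ | ⟨h0, -, h⟩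
    · exact absurd h hw
    · exact ⟨h0, h⟩
  have hinj : Function.Injective
      (fun u : {u : Fin 2 → ZMod q // pweight q 2 u = (w : ℚ)} => u.1 0) := by
    rintro ⟨u, hu⟩ ⟨v, hv⟩ (h : u 0 = v 0)
    refine Subtype.ext (funext (Fin.forall_fin_two.2 ⟨h, ?_⟩))
    apply ZMod.val_injective q
    have hu' := (key u hu).2
    have hv' := (key v hv).2
    rw [h] at hu'
    change (u 1).val = (v 1).val
    omega
  have hlt := Fintype.card_lt_of_injective_of_notMem _ hinj (b := 0) (by
    rintro ⟨⟨u, hu⟩, h⟩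
    exact (key u hu).1 h)
  rwa [ZMod.card, ← Nat.card_eq_fintype_card] at hlt

/-- for odd `q ≥ 3`, `r_{q,2,q} = q` and `r_{q,2,w} < q` for
`2 ≤ w ≤ 2q-2`, `w ≠ q`. -/
theorem stmt10 (q : ℕ) (hq : 3 ≤ q) (hodd : Odd q) :
    rcount q 2 (q : ℚ) = q ∧
      ∀ w : ℕ, 2 ≤ w → w ≤ 2 * q - 2 → w ≠ q → rcount q 2 (w : ℚ) < q := by
  have : NeZero q := ⟨by omega⟩
  exact ⟨rcount_two_self hodd, fun w _ _ hw => rcount_two_lt hodd hw⟩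
end

section
/- Let q ≥ 4 be even. Then r_{q,2,q} = q + 2, and for every w with 2 ≤ w ≤ 2q-2 and w ≠ q, r_{q,2,w} ≤ q. -/
/-- For `q = 2h`, counting pairs of residues of pseudoweight `w` amounts to counting pairs of
representatives in `[0, q-1]`, where `0` has weight `h`. -/
theorem rcount_two_eq_card (h w : ℕ) (hh : 0 < h) :
    rcount (h + h) 2 (w : ℚ) =
      ((Finset.range (h + h) ×ˢ Finset.range (h + h)).filter fun p : ℕ × ℕ =>
        (if p.1 = 0 then h else p.1) + (if p.2 = 0 then h else p.2) = w).card := by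
  have : NeZero (h + h) := ⟨by omega⟩
  have hweight (u : Fin 2 → ZMod (h + h)) : pweight (h + h) 2 u = (w : ℚ) ↔
      (if (u 0).val = 0 then h else (u 0).val) +
        (if (u 1).val = 0 then h else (u 1).val) = w := by
    rw [← Nat.cast_inj (R := ℚ)]
    simp only [pweight, Fin.sum_univ_two, ZMod.val_eq_zero, Nat.cast_add, Nat.cast_ite,
      add_self_div_two]
  classical
  rw [rcount, Nat.card_eq_fintype_card, Fintype.card_subtype]
  refine Finset.card_bij (fun u _ => ((u 0).val, (u 1).val)) ?_ ?_ ?_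
  · intro u hu
    simp only [Finset.mem_filter, Finset.mem_univ, true_and] at hu
    simp only [Finset.mem_filter, Finset.mem_product, Finset.mem_range]
    exact ⟨⟨ZMod.val_lt _, ZMod.val_lt _⟩, (hweight u).1 hu⟩
  · intro u _ v _ huv
    simp only [Prod.mk.injEq] at huv
    ext i
    fin_cases i
    · exact ZMod.val_injective _ huv.1
    · exact ZMod.val_injective _ huv.2
  · rintro ⟨a, b⟩ hab
    simp only [Finset.mem_filter, Finset.mem_product, Finset.mem_range] at hab
    obtain ⟨⟨ha, hb⟩, hab⟩ := hab
    have hu : ((![(a : ZMod (h + h)), (b : ZMod (h + h))] 0).val,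
        (![(a : ZMod (h + h)), (b : ZMod (h + h))] 1).val) = (a, b) := by
      simp [ZMod.val_cast_of_lt ha, ZMod.val_cast_of_lt hb, -Nat.cast_add]
    refine ⟨![(a : ZMod (h + h)), (b : ZMod (h + h))], ?_, hu⟩
    simp only [Prod.mk.injEq] at hu
    simp only [Finset.mem_filter, Finset.mem_univ, true_and]
    rw [hweight, hu.1, hu.2]
    exact hab

/-- for even `q ≥ 4`, `r_{q,2,q} = q + 2` and `r_{q,2,w} ≤ q` for
`2 ≤ w ≤ 2q-2`, `w ≠ q`. -/
theorem stmt11 (q : ℕ) (hq : 4 ≤ q) (heven : Even q) :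
    rcount q 2 (q : ℚ) = q + 2 ∧
      ∀ w : ℕ, 2 ≤ w → w ≤ 2 * q - 2 → w ≠ q → rcount q 2 (w : ℚ) ≤ q := by
  obtain ⟨h, rfl⟩ := heven
  constructor
  · rw [rcount_two_eq_card h _ (by omega)]
    conv_rhs => rw [← Finset.card_range (h + h + 2)]
    symm
    refine Finset.card_bij (fun i _ => if i = 0 then (0, 0) else if i < h + h then (i, h + h - i)
      else if i = h + h then (0, h) else (h, 0)) ?_ ?_ ?_
    · intro i hi
      simp only [Finset.mem_range] at hi
      simp only [Finset.mem_filter, Finset.mem_product, Finset.mem_range]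
      split_ifs <;> simp_all <;> omega
    · intro i hi j hj hij
      simp only [Finset.mem_range] at hi hj
      split_ifs at hij <;> simp only [Prod.mk.injEq] at hij <;> omega
    · rintro ⟨a, b⟩ hab
      simp only [Finset.mem_filter, Finset.mem_product, Finset.mem_range] at hab
      obtain ⟨⟨ha, hb⟩, hab⟩ := hab
      refine ⟨if a = 0 then (if b = 0 then 0 else h + h) else if b = 0 then h + h + 1 else a,
        ?_, ?_⟩
      · simp only [Finset.mem_range]
        split_ifs <;> omega
      · grind
  · intro w _ _ hw
    rw [rcount_two_eq_card h _ (by omega)]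
    conv_rhs => rw [← Finset.card_range (h + h)]
    refine Finset.card_le_card_of_injOn
      (fun p => if p.2 = 0 then (if w < h + h then h + h - 1 else 1) else p.1) ?_ ?_
    · rintro ⟨a, b⟩ hab
      simp only [Finset.coe_filter, Set.mem_ofPred_eq, Finset.mem_product, Finset.mem_range] at hab
      simp only [Finset.coe_range, Set.mem_Iio]
      split_ifs <;> omega
    · rintro ⟨a, b⟩ hab ⟨c, d⟩ hcd heq
      simp only [Finset.coe_filter, Set.mem_ofPred_eq, Finset.mem_product, Finset.mem_range]
        at hab hcd
      simp only at heq
      simp only [Prod.mk.injEq]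
      obtain ⟨⟨ha, hb⟩, hab⟩ := hab
      obtain ⟨⟨hc, hd⟩, hcd⟩ := hcd
      split_ifs at hab hcd heq <;> omega
end

section
/- For every n ≥ 1 and every i with 0 ≤ i ≤ 2n, the number of 3-ary n-tuples with pseudoweight exactly n + i/2 equals the coefficient of x^i in the polynomial (1 + x + x^2)^n (the trinomial coefficient N_2(i,n)). -/
/-- Twice the excess over `1` of the pseudoweight of a ternary symbol. -/
def ternaryExcess (a : ZMod 3) : ℕ :=
  if a = 0 then 1 else if a = 1 then 0 else 2

theorem ternary_symbol_weight (a : ZMod 3) :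
    (if a = 0 then ((3 : ℕ) : ℚ) / 2 else (a.val : ℚ)) = 1 + (ternaryExcess a : ℚ) / 2 := by
  have h : a = 0 ∨ a = 1 ∨ a = 2 := by revert a; decide
  have h10 : (1 : ZMod 3) ≠ 0 := by decide
  have h20 : (2 : ZMod 3) ≠ 0 := by decide
  have h21 : (2 : ZMod 3) ≠ 1 := by decide
  have hv1 : (1 : ZMod 3).val = 1 := rfl
  have hv2 : (2 : ZMod 3).val = 2 := rfl
  rcases h with rfl | rfl | rfl
  · norm_num [ternaryExcess]
  · rw [if_neg h10, hv1]
    norm_num [ternaryExcess, h10]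
  · rw [if_neg h20, hv2]
    norm_num [ternaryExcess, h20, h21]

theorem pweight_three (n : ℕ) (u : Fin n → ZMod 3) :
    pweight 3 n u = n + ((∑ j, ternaryExcess (u j) : ℕ) : ℚ) / 2 := by
  simp only [pweight, ternary_symbol_weight, Finset.sum_add_distrib, ← Finset.sum_div]
  simp

theorem sum_X_pow_ternaryExcess :
    ∑ a : ZMod 3, (Polynomial.X : Polynomial ℕ) ^ ternaryExcess a =
      1 + Polynomial.X + Polynomial.X ^ 2 := by
  have h : ∑ a : ZMod 3, (Polynomial.X : Polynomial ℕ) ^ ternaryExcess a =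
      Polynomial.X ^ 1 + Polynomial.X ^ 0 + Polynomial.X ^ 2 := Fin.sum_univ_three _
  rw [h]
  ring

/-- `r_{3,n,n+i/2}` is the trinomial coefficient `N_2(i,n)`, i.e. the
coefficient of `x^i` in `(1 + x + x^2)^n`. -/
theorem stmt13 (n : ℕ) (hn : 1 ≤ n) (i : ℕ) (hi : i ≤ 2 * n) :
    rcount 3 n ((n : ℚ) + (i : ℚ) / 2) =
      ((1 + Polynomial.X + Polynomial.X ^ 2 : Polynomial ℕ) ^ n).coeff i := by
  have hw (u : Fin n → ZMod 3) :
      pweight 3 n u = (n : ℚ) + (i : ℚ) / 2 ↔ i = ∑ j, ternaryExcess (u j) := by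
    rw [pweight_three, add_right_inj, div_left_inj' two_ne_zero, Nat.cast_inj, eq_comm]
  rw [← sum_X_pow_ternaryExcess, Fintype.sum_pow, Polynomial.finsetSum_coeff]
  simp only [rcount, hw, Finset.prod_pow_eq_pow_sum, Polynomial.coeff_X_pow]
  rw [Nat.card_eq_fintype_card, Fintype.card_subtype, Finset.card_filter]
end

section
/- For every n ≥ 1 and every integer w with n ≤ w ≤ 3n, the number of 4-ary n-tuples with pseudoweight exactly w equals the binomial coefficient C(2n, w-n). -/
open Polynomial in
/-- The coefficients of the `n`-th power of a weight enumerator count the `n`-tuples of given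
total weight. -/
theorem coeff_sum_X_pow_pow {α : Type*} [Fintype α] (g : α → ℕ) (n w : ℕ) :
    ((∑ a, (X : ℕ[X]) ^ g a) ^ n).coeff w =
      Nat.card {u : Fin n → α // ∑ i, g (u i) = w} := by
  classical
  simp [Fintype.sum_pow, Finset.prod_pow_eq_pow_sum, coeff_X_pow,
    Nat.card_eq_fintype_card, Fintype.card_subtype, eq_comm]

theorem pweight_four (n : ℕ) (u : Fin n → ZMod 4) :
    pweight 4 n u = ((∑ i, if u i = 0 then 2 else (u i).val : ℕ) : ℚ) := by
  unfold pweight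
  push_cast
  norm_num

open Polynomial in
theorem weight_enumerator_four :
    ∑ a : ZMod 4, (X : ℕ[X]) ^ (if a = 0 then 2 else a.val) = X * (1 + X) ^ 2 := by
  have h : ∑ a : ZMod 4, (X : ℕ[X]) ^ (if a = 0 then 2 else a.val) =
      X ^ 2 + X ^ 1 + X ^ 2 + X ^ 3 := Fin.sum_univ_four _
  rw [h]
  ring

/-- `r_{4,n,w}` is the binomial coefficient `C(2n, w-n)`. -/
theorem stmt14 (n : ℕ) (hn : 1 ≤ n) (w : ℕ) (h1 : n ≤ w) (h2 : w ≤ 3 * n) :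
    rcount 4 n (w : ℚ) = Nat.choose (2 * n) (w - n) := by
  simp only [rcount, pweight_four, Nat.cast_inj]
  rw [← coeff_sum_X_pow_pow (fun a : ZMod 4 => if a = 0 then 2 else a.val),
    weight_enumerator_four, mul_pow, ← pow_mul, Polynomial.coeff_X_pow_mul', if_pos h1,
    Polynomial.coeff_one_add_X_pow, Nat.cast_id]
end

section
/- Suppose n ≥ 2, q > 2, and S is a q-ary n-window sequence containing no zeros, with the property that every n-tuple of consecutive terms appearing in S has weight strictly less than nq/2. Then S is a negative orientable sequence of order n. -/
/-- A zero-free tuple and the negative of its reverse have weights summing to `n * q`. -/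
theorem sum_val_add_sum_val_of_eq_neg_rev {q n : ℕ} [NeZero q] {u v : Fin n → ZMod q}
    (hv : ∀ k, v k ≠ 0) (h : u = -(v ∘ Fin.rev)) :
    ∑ k, (u k).val + ∑ k, (v k).val = n * q := by
  rw [← Equiv.sum_comp Fin.revPerm fun k => (v k).val, ← Finset.sum_add_distrib]
  have key : ∀ k, (u k).val + (v (Fin.revPerm k)).val = q := fun k => by
    have : NeZero (v (Fin.rev k)) := ⟨hv _⟩
    have hlt := ZMod.val_lt (v (Fin.rev k))
    simp only [h, Pi.neg_apply, Function.comp_apply, Fin.revPerm_apply, ZMod.val_neg_of_ne_zero]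
    omega
  simp only [key, Finset.sum_const, Finset.card_univ, Fintype.card_fin, smul_eq_mul]

/-- a zero-free `n`-window sequence all of whose `n`-tuples have weight
less than `nq/2` is a negative orientable sequence of order `n`. -/
theorem stmt15 (q n m : ℕ) (hn : 2 ≤ n) (hq : 2 < q) (S : ℤ → ZMod q)
    (hwin : IsNWindowSeq q n m S) (hzero : ∀ i : ℤ, S i ≠ 0)
    (hwt : ∀ i : ℤ, ((∑ k : Fin n, (window q n S i k).val : ℕ) : ℚ) < (n : ℚ) * q / 2) :
    IsNOS q n m S := by
  have : NeZero q := ⟨by omega⟩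
  refine ⟨hwin, fun i j h => ?_⟩
  have hsum := sum_val_add_sum_val_of_eq_neg_rev (fun k => hzero (j + (k : ℕ))) h
  have hcast : ((∑ k : Fin n, (window q n S i k).val : ℕ) : ℚ) +
      ((∑ k : Fin n, (window q n S j k).val : ℕ) : ℚ) = n * q := mod_cast hsum
  linarith [hwt i, hwt j]
end

section
/- Let q > 2 with q ≠ 6, and let w ∈ Z_q be a non-unit (i.e. gcd(w,q) ≠ 1, treating w as an integer in [0,q-1]). Then there exists an integer d with 1 ≤ d ≤ ⌊(q-1)/2⌋ such that w - d is a unit in Z_q. -/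
theorem ZMod.isUnit_intCast_of_isCoprime {q : ℕ} {s : ℤ} (h : IsCoprime s q) :
    IsUnit (s : ZMod q) := by
  obtain ⟨a, b, hab⟩ := h
  have h1 : (a : ZMod q) * s = 1 := by simpa using congrArg (Int.cast : ℤ → ZMod q) hab
  exact IsUnit.of_mul_eq_one_right _ h1

/-- A residue coprime to `q` that is close to `q / 2`. -/
theorem exists_isCoprime_near_half (q : ℕ) (hq : 2 < q) (hq6 : q ≠ 6) :
    ∃ s : ℤ, s ≤ ((q - 1) / 2 : ℕ) + 1 ∧ (q : ℤ) ≤ 2 * s + ((q - 1) / 2 : ℕ) + 1 ∧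
      IsCoprime s q := by
  obtain ⟨k, hk | hk | hk⟩ : ∃ k, q = 2 * k + 1 ∨ q = 4 * k ∨ q = 4 * k + 2 :=
    if h : q % 2 = 1 then ⟨q / 2, by omega⟩ else ⟨q / 4, by omega⟩
  · exact ⟨k, by omega, by omega, -2, 1, by rw [hk]; push_cast; ring⟩
  · exact ⟨2 * k - 1, by omega, by omega, -(2 * k + 1), k, by rw [hk]; push_cast; ring⟩
  · exact ⟨2 * k - 1, by omega, by omega, 2 * k - 1 + 2 * k * (k - 1), -(k * (k - 1)), by
      rw [hk]; push_cast; ring⟩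

/-- for `q > 2`, `q ≠ 6`, and a non-unit `w ∈ Z_q`, there is
`1 ≤ d ≤ ⌊(q-1)/2⌋` with `w - d` a unit. -/
theorem stmt17 (q : ℕ) (hq : 2 < q) (hq6 : q ≠ 6) (w : ZMod q) (hw : ¬ IsUnit w) :
    ∃ d : ℕ, 1 ≤ d ∧ d ≤ (q - 1) / 2 ∧ IsUnit (w - (d : ZMod q)) := by
  have : NeZero q := ⟨by omega⟩
  obtain ⟨v, hvq, rfl⟩ : ∃ v : ℕ, v < q ∧ (v : ZMod q) = w :=
    ⟨w.val, w.val_lt, ZMod.natCast_zmod_val w⟩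
  obtain ⟨s, hs, hqs, hsq⟩ := exists_isCoprime_near_half q hq hq6
  have hs_unit : IsUnit ((s : ℤ) : ZMod q) := ZMod.isUnit_intCast_of_isCoprime hsq
  have of_unit (u : ℤ) (hu : IsUnit (u : ZMod q)) (h1 : u + 1 ≤ v)
      (h2 : v ≤ u + ((q - 1) / 2 : ℕ)) :
      ∃ d : ℕ, 1 ≤ d ∧ d ≤ (q - 1) / 2 ∧ IsUnit ((v : ZMod q) - (d : ZMod q)) := by
    obtain ⟨d, hd⟩ : ∃ d : ℕ, (v : ℤ) = u + d := ⟨(v - u).toNat, by omega⟩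
    refine ⟨d, by omega, by omega, ?_⟩
    have h := congrArg (Int.cast : ℤ → ZMod q) hd
    push_cast at h
    rwa [h, add_sub_cancel_right]
  have ne_of_unit (u : ℤ) (hu : IsUnit (u : ZMod q)) : (v : ℤ) ≠ u := by
    rintro rfl
    exact hw (by simpa using hu)
  have hqs_unit : IsUnit (((q - s : ℤ)) : ZMod q) := by simpa using hs_unit
  have hone : IsUnit (((1 : ℤ)) : ZMod q) := by simp
  have hneg : IsUnit (((-1 : ℤ)) : ZMod q) := by simp
  have := ne_of_unit _ hone
  have := ne_of_unit _ hs_unit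
  have := ne_of_unit _ hqs_unit
  by_cases h0 : v = 0
  · exact of_unit _ hneg (by omega) (by omega)
  by_cases h1 : (v : ℤ) ≤ 1 + ((q - 1) / 2 : ℕ)
  · exact of_unit _ hone (by omega) h1
  by_cases h2 : (v : ℤ) ≤ s + ((q - 1) / 2 : ℕ)
  · exact of_unit _ hs_unit (by omega) h2
  · exact of_unit _ hqs_unit (by omega) (by omega)
end

section
/- Let q > 2. There exists a q-ary orientable sequence of order 3 whose period is at least q·(q(q-1)/2 - 1) if q is odd; at least q·(q(q-1)/2 - 2) if q is even and q ≠ 6; and at least q·(q(q-1)/2 - 3) if q = 6. -/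
open Equiv in
/-- If `e` and `f` lie on different cycles of `σ`, then composing `σ` with `swap e f` merges them. -/
lemma sameCycle_swap_mul {E : Type*} [Fintype E] [DecidableEq E] (σ : Perm E) {e f : E}
    (h : ¬ σ.SameCycle e f) : (swap e f * σ).SameCycle e f := by
  have hex : ∃ n : ℕ, 0 < n ∧ (σ ^ n) e = e :=
    ⟨orderOf σ, orderOf_pos σ, by rw [pow_orderOf_eq_one]; rfl⟩
  classical
  obtain ⟨hp, hpe⟩ := Nat.find_spec hex
  have hmin := fun k hk => Nat.find_min hex (m := k) hk
  generalize Nat.find hex = p at hp hpe hmin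
  have hpow : ∀ n < p, ((swap e f * σ) ^ n) e = (σ ^ n) e := by
    intro n
    induction n with
    | zero => intro _; rfl
    | succ n ih =>
      intro hn
      rw [pow_succ', Perm.mul_apply, ih (by omega), Perm.mul_apply, ← Perm.mul_apply σ,
        ← pow_succ', swap_apply_of_ne_of_ne]
      · exact fun hc => hmin _ hn ⟨by omega, hc⟩
      · exact fun hc => h ⟨(n + 1 : ℕ), by rw [zpow_natCast]; exact hc⟩
  obtain ⟨n, rfl⟩ : ∃ n, p = n + 1 := ⟨p - 1, by omega⟩
  refine ⟨(n + 1 : ℕ), ?_⟩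
  rw [zpow_natCast, pow_succ', Perm.mul_apply, hpow n (by omega), Perm.mul_apply,
    ← Perm.mul_apply σ, ← pow_succ', hpe, swap_apply_left]

open Equiv in
lemma SameCycle.swap_mul_mono {E : Type*} [Fintype E] [DecidableEq E] (σ : Perm E) {e f : E}
    (h : ¬ σ.SameCycle e f) {x y : E} (hxy : σ.SameCycle x y) : (swap e f * σ).SameCycle x y := by
  have hef := sameCycle_swap_mul σ h
  have step : ∀ x, (swap e f * σ).SameCycle x (σ x) := by
    intro x
    have h1 : (swap e f * σ).SameCycle x (swap e f (σ x)) := ⟨1, by simp⟩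
    by_cases he : σ x = e
    · rw [he, swap_apply_left] at h1
      rw [he]
      exact h1.trans hef.symm
    by_cases hf : σ x = f
    · rw [hf, swap_apply_right] at h1
      rw [hf]
      exact h1.trans hef
    rwa [swap_apply_of_ne_of_ne he hf] at h1
  obtain ⟨n, rfl⟩ := hxy.exists_nat_pow_eq
  induction n with
  | zero => exact Perm.SameCycle.refl _ _
  | succ n ih =>
    rw [pow_succ', Perm.mul_apply]
    exact (ih ⟨n, by simp⟩).trans (step _)

open Equiv in
/-- Euler's theorem for a finite digraph with edge type `E`, in terms of permutations: if some
permutation sends each edge to an edge starting at its target, and the digraph is connected, then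
there is such a permutation consisting of a single cycle. -/
theorem exists_eulerian_perm {E V : Type*} [Fintype E] [DecidableEq E] (src tgt : E → V)
    (σ₀ : Perm E) (h₀ : ∀ e, src (σ₀ e) = tgt e)
    (hconn : ∀ r : Setoid E, (∀ e f, src e = src f → r e f) → (∀ e f, src f = tgt e → r e f) →
      ∀ e f, r e f) :
    ∃ σ : Perm E, (∀ e, src (σ e) = tgt e) ∧ ∀ e f, σ.SameCycle e f := by
  classical
  obtain ⟨σ, hσ, hmax⟩ := Finset.exists_max_image
    (Finset.univ.filter fun σ : Perm E => ∀ e, src (σ e) = tgt e)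
    (fun σ => (Finset.univ.filter fun p : E × E => σ.SameCycle p.1 p.2).card)
    ⟨σ₀, by simpa using h₀⟩
  simp only [Finset.mem_filter, Finset.mem_univ, true_and] at hσ hmax
  refine ⟨σ, hσ, ?_⟩
  have hsrc : ∀ e f, src e = src f → σ.SameCycle e f := by
    intro e f hef
    by_contra hne
    refine absurd (hmax (swap e f * σ) fun x => ?_) (not_le.mpr (Finset.card_lt_card ?_))
    · rw [Perm.mul_apply, ← hσ x]
      by_cases he : σ x = e
      · rw [he, swap_apply_left, hef]
      by_cases hf : σ x = f
      · rw [hf, swap_apply_right, hef]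
      rw [swap_apply_of_ne_of_ne he hf]
    · refine (Finset.ssubset_iff_of_subset fun p hp => ?_).mpr ⟨(e, f), ?_, ?_⟩
      · simp only [Finset.mem_filter, Finset.mem_univ, true_and] at hp ⊢
        exact SameCycle.swap_mul_mono σ hne hp
      · simpa using sameCycle_swap_mul σ hne
      · simpa using hne
  refine hconn (Perm.SameCycle.setoid σ) hsrc fun e f hef => ?_
  have h1 : σ.SameCycle e (σ e) := ⟨1, by simp⟩
  exact h1.trans (hsrc _ _ (by rw [hσ, hef]))

/-- A choice of pairs of consecutive differences containing at most one of `(x, y)` and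
`(-y, -x)`, given on representatives in `[0, q)`. -/
def DiffRel (q a b : ℕ) : Prop :=
  (0 < a ∧ 2 * a < q ∧ 0 < b ∧ 2 * b < q ∧ a ≤ b) ∨
  (q < 2 * a ∧ q < 2 * b ∧ b < a) ∨
  (0 < a ∧ 2 * a < q ∧ q < 2 * b ∧ q < a + b) ∨
  (q < 2 * a ∧ 0 < b ∧ 2 * b < q ∧ a + b < q) ∨
  (0 < a ∧ 2 * a < q ∧ (b = 0 ∨ 2 * b = q)) ∨
  ((a = 0 ∨ 2 * a = q) ∧ 0 < b ∧ 2 * b < q)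

lemma ZMod.val_neg_cases {q : ℕ} [NeZero q] (x : ZMod q) :
    (x.val = 0 ∧ (-x).val = 0) ∨ (0 < x.val ∧ x.val < q ∧ (-x).val + x.val = q) := by
  have hx := ZMod.val_lt x
  rw [ZMod.neg_val]
  split_ifs with h
  · simp [h]
  · have : x.val ≠ 0 := by simpa using h
    omega

lemma DiffRel.not_neg {q : ℕ} [NeZero q] {x y : ZMod q} (h : DiffRel q x.val y.val) :
    ¬ DiffRel q (-y).val (-x).val := by
  have hx := ZMod.val_neg_cases x
  have hy := ZMod.val_neg_cases y
  unfold DiffRel at *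
  omega

/-- The successor of a pair of differences: `(x, y)` is followed by `(y, -x)` or by `(y, x)`. -/
def nextDiff (q : ℕ) (x y : ZMod q) : ZMod q :=
  if x.val = y.val ∨ x.val = 0 ∨ 2 * x.val = q ∨ y.val = 0 ∨ 2 * y.val = q then x else -x

lemma DiffRel.next {q : ℕ} [NeZero q] {x y : ZMod q} (h : DiffRel q x.val y.val) :
    DiffRel q y.val (nextDiff q x y).val := by
  have hx := ZMod.val_neg_cases x
  have hy := ZMod.val_neg_cases y
  unfold nextDiff
  unfold DiffRel at h
  split_ifs with hc
  · rcases h with h | h | h | h | h | h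
    · exact .inl <| by omega
    · omega
    · omega
    · omega
    · exact .inr <| .inr <| .inr <| .inr <| .inr <| by omega
    · exact .inr <| .inr <| .inr <| .inr <| .inl <| by omega
  · rcases h with h | h | h | h | h | h
    · exact .inr <| .inr <| .inl <| by omega
    · exact .inr <| .inr <| .inr <| .inl <| by omega
    · exact .inr <| .inl <| by omega
    · exact .inl <| by omega
    · omega
    · omega

lemma nextDiff_left_injOn {q : ℕ} [NeZero q] {x x' y : ZMod q} (h : DiffRel q x.val y.val)
    (h' : DiffRel q x'.val y.val) (he : nextDiff q x y = nextDiff q x' y) : x = x' := by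
  have hx := ZMod.val_neg_cases x
  have hx' := ZMod.val_neg_cases x'
  apply ZMod.val_injective q
  have he := congrArg ZMod.val he
  unfold nextDiff at he
  unfold DiffRel at *
  split_ifs at he <;> omega

/-- Triples given by a first term and two differences, the differences satisfying `DiffRel`. -/
abbrev DiffEdge (q : ℕ) : Type :=
  ZMod q × {p : ZMod q × ZMod q // DiffRel q p.1.val p.2.val}

/-- The map sending a triple to a triple that overlaps it in two terms. -/
def DiffEdge.next {q : ℕ} [NeZero q] (e : DiffEdge q) : DiffEdge q :=
  (e.1 + e.2.1.1, ⟨(e.2.1.2, nextDiff q e.2.1.1 e.2.1.2), e.2.2.next⟩)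

lemma DiffEdge.next_injective {q : ℕ} [NeZero q] : Function.Injective (DiffEdge.next (q := q)) := by
  rintro ⟨a, ⟨⟨x, y⟩, h⟩⟩ ⟨a', ⟨⟨x', y'⟩, h'⟩⟩ he
  simp only [DiffEdge.next, Prod.mk.injEq, Subtype.mk.injEq] at he
  obtain ⟨h1, rfl, h3⟩ := he
  obtain rfl := nextDiff_left_injOn h h' h3
  obtain rfl := add_right_cancel h1
  rfl

/-- The first overlap vertex of a triple. -/
def DiffEdge.src {q : ℕ} (e : DiffEdge q) : ZMod q × ZMod q := (e.1, e.2.1.1)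

/-- The last overlap vertex of a triple. -/
def DiffEdge.tgt {q : ℕ} (e : DiffEdge q) : ZMod q × ZMod q := (e.1 + e.2.1.1, e.2.1.2)

lemma DiffEdge.connected {q : ℕ} [NeZero q] (hq : 2 < q) (r : Setoid (DiffEdge q))
    (hsrc : ∀ e f : DiffEdge q, e.src = f.src → r e f)
    (htgt : ∀ e f : DiffEdge q, f.src = e.tgt → r e f) (e f : DiffEdge q) : r e f := by
  have h1v : (1 : ZMod q).val = 1 := by
    have : Fact (1 < q) := ⟨by omega⟩
    exact ZMod.val_one q
  have h11 : DiffRel q (1 : ZMod q).val (1 : ZMod q).val := by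
    rw [h1v]; unfold DiffRel; omega
  let u : ZMod q → DiffEdge q := fun a => (a, ⟨(1, 1), h11⟩)
  have hu : ∀ n : ℕ, r (u n) (u 0) := by
    intro n
    induction n with
    | zero => rw [Nat.cast_zero]
    | succ n ih => exact r.trans (r.symm (htgt _ _ (by simp [u, src, tgt]))) ih
  have hu : ∀ a, r (u a) (u 0) := fun a => by
    simpa using hu a.val
  have hpos : ∀ e : DiffEdge q, 2 * e.2.1.1.val ≤ q → r e (u 0) := by
    rintro ⟨a, ⟨⟨x, y⟩, h⟩⟩ hx
    have hx1 : DiffRel q (1 : ZMod q).val x.val := by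
      simp only at hx
      rw [h1v]; unfold DiffRel; omega
    let g : DiffEdge q := (a - 1, ⟨(1, x), hx1⟩)
    have hg : r g (u (a - 1)) := hsrc _ _ rfl
    exact r.trans (r.symm (htgt g _ (by simp [g, src, tgt]))) (r.trans hg (hu _))
  have hall : ∀ e : DiffEdge q, r e (u 0) := by
    intro e
    by_cases h1 : 2 * e.2.1.1.val ≤ q
    · exact hpos e h1
    refine r.trans (htgt e e.next rfl) ?_
    by_cases h2 : 2 * e.2.1.2.val ≤ q
    · exact hpos _ h2
    refine r.trans (htgt _ e.next.next rfl) (hpos _ ?_)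
    obtain ⟨a, ⟨⟨x, y⟩, h⟩⟩ := e
    have hx := ZMod.val_neg_cases x
    simp only [next, nextDiff] at *
    have := ZMod.val_lt x
    have := ZMod.val_lt y
    have h : DiffRel q x.val y.val := h
    unfold DiffRel at h
    split_ifs <;> omega
  exact r.trans (hall e) (r.symm (hall f))

open Classical in
lemma card_diffRel {q : ℕ} [NeZero q] :
    q * q ≤ 2 * Nat.card {p : ZMod q × ZMod q // DiffRel q p.1.val p.2.val} + q + 2 := by
  rw [Nat.card_eq_fintype_card, Fintype.card_subtype]
  set B := Finset.univ.filter fun p : ZMod q × ZMod q => DiffRel q p.1.val p.2.val with hB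
  let B' := B.image fun p => (-p.2, -p.1)
  let D := (Finset.univ : Finset (ZMod q)).image fun x => (x, -x)
  let h : ZMod q := ((q / 2 : ℕ) : ZMod q)
  let T : Finset (ZMod q × ZMod q) := {(0, h), (h, 0)}
  have hcover : (Finset.univ : Finset (ZMod q × ZMod q)) ⊆ (B ∪ B') ∪ D ∪ T := by
    rintro ⟨x, y⟩ -
    by_contra hc
    simp only [Finset.mem_union, not_or] at hc
    obtain ⟨⟨⟨h1, h2⟩, h3⟩, h4⟩ := hc
    have h1 : ¬ DiffRel q x.val y.val := by simpa [hB] using h1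
    have h2 : ¬ DiffRel q (-y).val (-x).val := fun hr => h2 <|
      Finset.mem_image.mpr ⟨(-y, -x), by simpa [hB] using hr, by simp⟩
    have h3 : ¬ y.val = (-x).val := fun hr => h3 <|
      Finset.mem_image.mpr ⟨x, Finset.mem_univ _, by rw [ZMod.val_injective q hr]⟩
    have hhalf : ∀ z : ZMod q, 2 * z.val = q → z = h := fun z hz => by
      rw [← ZMod.natCast_zmod_val z]
      congr 1
      omega
    have h5 : ¬ (x.val = 0 ∧ 2 * y.val = q) := fun hr => h4 <| by
      simp [T, (ZMod.val_eq_zero x).mp hr.1, hhalf y hr.2]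
    have h6 : ¬ (2 * x.val = q ∧ y.val = 0) := fun hr => h4 <| by
      simp [T, (ZMod.val_eq_zero y).mp hr.2, hhalf x hr.1]
    have hx := ZMod.val_neg_cases x
    have hy := ZMod.val_neg_cases y
    unfold DiffRel at *
    omega
  have hcard := Finset.card_le_card hcover
  rw [Finset.card_univ, Fintype.card_prod, ZMod.card] at hcard
  have hB' : B'.card ≤ B.card := Finset.card_image_le
  have hD : D.card ≤ q := Finset.card_image_le.trans (by rw [Finset.card_univ, ZMod.card])
  have hT : T.card ≤ 2 := Finset.card_le_two
  have k1 := Finset.card_union_le ((B ∪ B') ∪ D) T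
  have k2 := Finset.card_union_le (B ∪ B') D
  have k3 := Finset.card_union_le B B'
  omega

/-- There is an orientable sequence of order `3` whose triples are those given by `DiffRel`. -/
theorem exists_isOS_three (q : ℕ) (hq : 2 < q) :
    ∃ (m : ℕ) (S : ℤ → ZMod q), IsOS q 3 m S ∧ q * (q * q) ≤ 2 * m + q * (q + 2) := by
  classical
  have : NeZero q := ⟨by omega⟩
  have : Fact (1 < q) := ⟨by omega⟩
  obtain ⟨σ, hσ, hcyc⟩ := exists_eulerian_perm DiffEdge.src DiffEdge.tgt
    (Equiv.ofBijective DiffEdge.next (Finite.injective_iff_bijective.mp DiffEdge.next_injective))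
    (fun _ => rfl) (DiffEdge.connected hq)
  have h11 : DiffRel q (1 : ZMod q).val (1 : ZMod q).val := by
    rw [ZMod.val_one]; unfold DiffRel; omega
  let e₀ : DiffEdge q := (0, ⟨(1, 1), h11⟩)
  have hon : σ.IsCycleOn (Finset.univ : Finset (DiffEdge q)) :=
    ⟨by simp, fun x _ y _ => hcyc x y⟩
  let g : ℤ → DiffEdge q := fun i => (σ ^ i) e₀
  have hg1 : ∀ i, g (i + 1) = σ (g i) := fun i => by
    simp only [g]
    rw [add_comm, zpow_add, zpow_one, Equiv.Perm.mul_apply]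
  have hfst : ∀ i, (g (i + 1)).1 = (g i).1 + (g i).2.1.1 := fun i => by
    rw [hg1]; exact congrArg Prod.fst (hσ (g i))
  have hsnd : ∀ i, (g (i + 1)).2.1.1 = (g i).2.1.2 := fun i => by
    rw [hg1]; exact congrArg Prod.snd (hσ (g i))
  have hw0 : ∀ i, window q 3 (fun i => (g i).1) i 0 = (g i).1 := fun i => by simp [window]
  have hw1 : ∀ i, window q 3 (fun i => (g i).1) i 1 = (g i).1 + (g i).2.1.1 := fun i => by
    simp [window, hfst]
  have hw2 : ∀ i, window q 3 (fun i => (g i).1) i 2 = (g i).1 + (g i).2.1.1 + (g i).2.1.2 :=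
    fun i => by
      have : i + 2 = i + 1 + 1 := by ring
      simp [window, this, hfst, hsnd]
  have hper : ∀ n : ℤ, (σ ^ n) e₀ = e₀ ↔ (Fintype.card (DiffEdge q) : ℤ) ∣ n := fun n => by
    rw [hon.zpow_apply_eq (Finset.mem_univ _), Finset.card_univ]
  refine ⟨Fintype.card (DiffEdge q), fun i => (g i).1,
    ⟨⟨by omega, by omega, Fintype.card_pos_iff.mpr ⟨e₀⟩, fun i => ?_, fun i j hij => ?_⟩,
      fun i j hij => ?_⟩, ?_⟩
  · simp only [g]
    rw [zpow_add, Equiv.Perm.mul_apply, (hper _).mpr dvd_rfl]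
  · have k0 := congrFun hij 0
    have k1 := congrFun hij 1
    have k2 := congrFun hij 2
    rw [hw0, hw0] at k0
    rw [hw1, hw1, k0] at k1
    have k1 := add_left_cancel k1
    rw [hw2, hw2, k0, k1] at k2
    have k2 := add_left_cancel k2
    have hg : g i = g j := Prod.ext k0 (Subtype.ext (Prod.ext k1 k2))
    refine (hper _).mp ?_
    rw [sub_eq_neg_add, zpow_add, Equiv.Perm.mul_apply, zpow_neg, Equiv.Perm.inv_eq_iff_eq]
    exact hg
  · have k0 : window q 3 _ i 0 = window q 3 _ j 2 := congrFun hij 0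
    have k1 : window q 3 _ i 1 = window q 3 _ j 1 := congrFun hij 1
    have k2 : window q 3 _ i 2 = window q 3 _ j 0 := congrFun hij 2
    rw [hw0, hw2] at k0
    rw [hw1, hw1] at k1
    rw [hw2, hw0] at k2
    have hx : (g j).2.1.1 = -(g i).2.1.2 := by linear_combination k2 - k1
    have hy : (g j).2.1.2 = -(g i).2.1.1 := by linear_combination k1 - k0
    have hj := (g j).2.2
    rw [hx, hy] at hj
    exact (g i).2.2.not_neg hj
  · rw [Fintype.card_prod, ZMod.card]
    have := Nat.mul_le_mul_left q (card_diffRel (q := q))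
    rw [Nat.card_eq_fintype_card] at this
    linarith

/-- existence of an `OS_q(3)` of large period. -/
theorem stmt18 (q : ℕ) (hq : 2 < q) :
    ∃ (m : ℕ) (S : ℤ → ZMod q), IsOS q 3 m S ∧
      (if Odd q then (q : ℚ) * ((q : ℚ) * ((q : ℚ) - 1) / 2 - 1)
       else if q ≠ 6 then (q : ℚ) * ((q : ℚ) * ((q : ℚ) - 1) / 2 - 2)
       else (q : ℚ) * ((q : ℚ) * ((q : ℚ) - 1) / 2 - 3)) ≤ (m : ℚ) := by
  obtain ⟨m, S, hS, hm⟩ := exists_isOS_three q hq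
  refine ⟨m, S, hS, ?_⟩
  have hm' : (q : ℚ) * (q * q) ≤ 2 * m + q * (q + 2) := by exact_mod_cast hm
  have hq0 : (0 : ℚ) ≤ q := Nat.cast_nonneg q
  split_ifs <;> linarith
end

section
/- Let n > 2 and q > 2. There exists a q-ary orientable sequence of order n whose period is at least q·(q^{n-1} - r_{q,n-1,(n-1)q/2} - 2)/2 if q ≠ 6, and at least q·(q^{n-1} - r_{q,n-1,(n-1)q/2} - 4)/2 if q = 6, where r_{q,n-1,s} denotes the number of q-ary (n-1)-tuples with pseudoweight exactly s. -/
namespace OrientableSeq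

open Equiv.Perm Finset

section Merging

variable {α β : Type*} [DecidableEq α]

/-- A set closed under `σ * swap e e'` that contains `e'` contains the `σ`-orbit of `e`,
provided `e` and `e'` lie on different cycles of `σ`. -/
theorem mem_of_sameCycle_of_closed_mul_swap [Finite α] {σ : Equiv.Perm α} {e e' : α}
    (h : ¬ σ.SameCycle e e') {B : Set α} (hB : ∀ x ∈ B, (σ * Equiv.swap e e') x ∈ B)
    (he' : e' ∈ B) {x : α} (hx : σ.SameCycle e x) : x ∈ B := by
  have key : ∀ k : ℕ, (σ ^ (k + 1)) e ∈ B := by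
    intro k
    induction k with
    | zero => simpa using hB e' he'
    | succ k ih =>
      have hne : (σ ^ (k + 1)) e ≠ e' := fun h' => h ⟨(k + 1 : ℕ), by rwa [zpow_natCast]⟩
      by_cases hk : (σ ^ (k + 1)) e = e
      · rw [pow_succ', mul_apply, hk]
        simpa using hB e' he'
      · have := hB _ ih
        rwa [mul_apply, Equiv.swap_apply_of_ne_of_ne hk hne, ← mul_apply, ← pow_succ'] at this
  obtain ⟨i, hi, -, rfl⟩ := hx.exists_pow_eq''
  obtain ⟨k, rfl⟩ : ∃ k, i = k + 1 := ⟨i - 1, by omega⟩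
  exact key k

theorem sameCycle_mul_swap [Finite α] {σ : Equiv.Perm α} {e e' : α}
    (h : ¬ σ.SameCycle e e') :
    (σ * Equiv.swap e e').SameCycle e e' ∧
      ∀ x, σ.SameCycle e x → (σ * Equiv.swap e e').SameCycle e x := by
  have hcl : ∀ x ∈ {x | (σ * Equiv.swap e e').SameCycle e x},
      (σ * Equiv.swap e e') x ∈ {x | (σ * Equiv.swap e e').SameCycle e x} :=
    fun x hx => sameCycle_apply_right.2 hx
  have he' : (σ * Equiv.swap e e').SameCycle e e' := by
    have h2 : ¬ σ.SameCycle e' e := fun h' => h h'.symm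
    refine mem_of_sameCycle_of_closed_mul_swap h2
      (B := {x | (σ * Equiv.swap e e').SameCycle e x}) ?_ (SameCycle.refl _ _) (SameCycle.refl _ _)
    rw [Equiv.swap_comm e' e]
    exact hcl
  exact ⟨he', fun x hx => mem_of_sameCycle_of_closed_mul_swap h hcl he' hx⟩

/-- Euler circuits by merging cycles: `t` records the end vertex of an edge and `σ₀` is a
successor permutation. -/
theorem exists_perm_sameCycle [Fintype α] (t : α → β) (σ₀ : Equiv.Perm α) (z : α)
    (hconn : ∀ O : Set α, z ∈ O → (∀ e ∈ O, σ₀ e ∈ O) →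
      (∀ e ∈ O, ∀ e', t e' = t e → e' ∈ O) → ∀ e, e ∈ O) :
    ∃ σ : Equiv.Perm α, (∀ e, t (σ₀⁻¹ (σ e)) = t e) ∧ ∀ e, σ.SameCycle z e := by
  classical
  obtain ⟨σ, hσ, hmax⟩ := Finset.exists_max_image
    (univ.filter fun σ : Equiv.Perm α => ∀ e, t (σ₀⁻¹ (σ e)) = t e)
    (fun σ => (univ.filter fun x => σ.SameCycle z x).card)
    ⟨σ₀, by simp⟩
  simp only [mem_filter, mem_univ, true_and] at hσ hmax
  have htail : ∀ e, σ.SameCycle z e → ∀ e', t e' = t e → σ.SameCycle z e' := by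
    intro e he e' hee'
    by_contra hne
    have hnc : ¬ σ.SameCycle e e' := fun h => hne (he.trans h)
    obtain ⟨h1, h2⟩ := sameCycle_mul_swap hnc
    have hz := (h2 z he.symm).symm
    have hle := hmax (σ * Equiv.swap e e') (by
      intro x
      rw [mul_apply, hσ, Equiv.swap_apply_def]
      split_ifs with hx hx <;> simp_all)
    refine absurd hle (not_le.2 (Finset.card_lt_card ?_))
    refine Finset.ssubset_iff_of_subset (fun x hx => ?_) |>.2 ⟨e', ?_, ?_⟩
    · simp only [mem_filter, mem_univ, true_and] at hx ⊢
      exact hz.trans (h2 x (he.symm.trans hx))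
    · simpa using hz.trans h1
    · simpa using hne
  refine ⟨σ, hσ, hconn {x | σ.SameCycle z x} (SameCycle.refl _ _) (fun e he => ?_) htail⟩
  have h : σ.SameCycle z (σ⁻¹ (σ₀ e)) :=
    htail e he _ (by rw [← hσ (σ⁻¹ (σ₀ e))]; simp)
  simpa using sameCycle_apply_right.2 h

end Merging

theorem exists_int_antidifference {G : Type*} [AddCommGroup G] (T : ℤ → G) :
    ∃ S : ℤ → G, ∀ i, S (i + 1) = S i + T i := by
  let F : Equiv.Perm (ℤ × G) :=
    { toFun := fun p => (p.1 + 1, p.2 + T p.1)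
      invFun := fun p => (p.1 - 1, p.2 - T (p.1 - 1))
      left_inv := fun p => by simp
      right_inv := fun p => by simp }
  have h1 : ∀ i : ℤ, ((F ^ i) (0, 0)).1 = i := by
    intro i
    induction i using Int.induction_on with
    | zero => simp
    | succ i ih =>
      have h : (F ((F ^ (i : ℤ)) (0, 0))).1 = ((F ^ (i : ℤ)) (0, 0)).1 + 1 := rfl
      rw [add_comm, zpow_one_add, mul_apply, h, ih, add_comm]
    | pred i ih =>
      have : (F ((F ^ (-(i : ℤ) - 1)) (0, 0))).1 = -(i : ℤ) := by
        rw [← mul_apply, ← zpow_one_add]; simpa using ih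
      have h : (F ((F ^ (-(i : ℤ) - 1)) (0, 0))).1 = ((F ^ (-(i : ℤ) - 1)) (0, 0)).1 + 1 := rfl
      omega
  refine ⟨fun i => ((F ^ i) (0, 0)).2, fun i => ?_⟩
  dsimp only
  rw [add_comm i 1, zpow_one_add, mul_apply]
  have h : (F ((F ^ i) (0, 0))).2 = ((F ^ i) (0, 0)).2 + T ((F ^ i) (0, 0)).1 := rfl
  rw [h, h1]

theorem isUnit_intCast_of_isCoprime {q : ℕ} {u : ℤ} (h : IsCoprime u (q : ℤ)) :
    IsUnit (u : ZMod q) := by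
  obtain ⟨a, b, hab⟩ := h
  refine .of_mul_eq_one_right (a : ZMod q) ?_
  simpa using congrArg (Int.cast : ℤ → ZMod q) hab

/-- Any residue is, up to a shift by a natural number less than `q / 2`, a unit. -/
theorem exists_isUnit_sub {q : ℕ} (hq : 2 < q) (hq6 : q ≠ 6) (w : ℕ) (hw : w < q) :
    ∃ a : ℕ, 2 * a < q ∧ IsUnit ((w : ZMod q) - a) := by
  suffices h : ∃ u : ℤ, u ≤ w ∧ 2 * (w - u) < q ∧ IsCoprime u (q : ℤ) by
    obtain ⟨u, h1, h2, h3⟩ := h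
    refine ⟨(w - u).toNat, by omega, ?_⟩
    have : ((w : ZMod q) - ((w - u).toNat : ℕ)) = (u : ZMod q) := by
      have : (((w - u).toNat : ℕ) : ℤ) = w - u := by omega
      rw [← Int.cast_natCast (w - u).toNat, this]
      push_cast
      ring
    rw [this]
    exact isUnit_intCast_of_isCoprime h3
  rcases Nat.eq_zero_or_pos w with rfl | hw0
  · exact ⟨-1, by omega, by push_cast; omega, isCoprime_one_left.neg_left⟩
  by_cases hs : 2 * (w - 1) < q
  · exact ⟨1, by omega, by omega, isCoprime_one_left⟩
  have hmod : q % 2 = 1 ∨ q % 4 = 0 ∨ q % 4 = 2 := by omega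
  rcases hmod with h | h | h
  · obtain ⟨k, rfl⟩ : ∃ k, q = 2 * k + 1 := ⟨q / 2, by omega⟩
    exact ⟨k + 1, by omega, by omega, 2, -1, by push_cast; ring⟩
  · obtain ⟨k, rfl⟩ : ∃ k, q = 4 * k := ⟨q / 4, by omega⟩
    exact ⟨2 * k + 1, by omega, by omega, 2 * k + 1, -(k + 1), by push_cast; ring⟩
  · obtain ⟨k, rfl⟩ : ∃ k, q = 4 * k + 2 := ⟨q / 4, by omega⟩
    have h4 : ∀ v : ℤ, IsCoprime (2 * v + 1) 4 := fun v => by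
      have h2 : IsCoprime (2 * v + 1) 2 := ⟨1, -v, by ring⟩
      simpa using h2.mul_right h2
    by_cases hk : w = 2 * k + 2
    · refine ⟨2 * (k - 1) + 1, by omega, by omega, ?_⟩
      have hk' : ((4 * k + 2 : ℕ) : ℤ) = 4 + (2 * (k - 1) + 1) * 2 := by push_cast; ring
      rw [hk']
      exact (h4 (k - 1)).add_mul_left_right 2
    · refine ⟨2 * (k + 1) + 1, by omega, by omega, ?_⟩
      have hk' : ((4 * k + 2 : ℕ) : ℤ) = -4 + (2 * (k + 1) + 1) * 2 := by push_cast; ring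
      rw [hk']
      exact (h4 (k + 1)).neg_right.add_mul_left_right 2

theorem exists_finset_isUnit_sub_sum {q : ℕ} (hq : 2 < q) (W : ZMod q) :
    ∃ A : Finset (ZMod q), (∀ a ∈ A, a ≠ 0 ∧ 2 * a.val < q) ∧
      A.card ≤ (if q ≠ 6 then 1 else 2) ∧ IsUnit (W - ∑ a ∈ A, a) := by
  have : NeZero q := ⟨by omega⟩
  by_cases hq6 : q = 6
  · subst hq6
    simp only [ne_eq, not_true_eq_false, if_false]
    have h : ∀ W : ZMod 6, ∃ A ∈ ({∅, {1}, {2}, {1, 2}} : Finset (Finset (ZMod 6))),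
        (W - ∑ a ∈ A, a) * (W - ∑ a ∈ A, a) = 1 := by decide
    obtain ⟨A, hA, hu⟩ := h W
    refine ⟨A, ?_, ?_, .of_mul_eq_one _ hu⟩
    · clear hu; revert A; decide
    · clear hu; revert A; decide
  · obtain ⟨a, ha, hu⟩ := exists_isUnit_sub hq hq6 W.val (ZMod.val_lt W)
    rw [ZMod.natCast_zmod_val] at hu
    rw [if_pos hq6]
    by_cases h0 : (a : ZMod q) = 0
    · exact ⟨∅, by simp, by simp, by simpa [h0] using hu⟩
    · refine ⟨{(a : ZMod q)}, ?_, by simp, by simpa using hu⟩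
      simp only [Finset.mem_singleton, forall_eq]
      exact ⟨h0, by rwa [ZMod.val_natCast_of_lt (by omega)]⟩

section Weight

variable {q : ℕ}

/-- The contribution of a single letter to the pseudoweight. -/
def letterWeight (q : ℕ) (a : ZMod q) : ℚ :=
  if a = 0 then (q : ℚ) / 2 else (a.val : ℚ)

theorem pweight_eq_sum (N : ℕ) (u : Fin N → ZMod q) :
    pweight q N u = ∑ i, letterWeight q (u i) := rfl

theorem letterWeight_neg [NeZero q] (a : ZMod q) :
    letterWeight q (-a) = q - letterWeight q a := by
  unfold letterWeight
  by_cases h : a = 0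
  · simp [h]
    ring
  · have : NeZero a := ⟨h⟩
    rw [if_neg (neg_ne_zero.2 h), if_neg h, ZMod.val_neg_of_ne_zero,
      Nat.cast_sub (ZMod.val_lt a).le]

theorem one_le_letterWeight (hq : 2 < q) (a : ZMod q) : 1 ≤ letterWeight q a := by
  unfold letterWeight
  have hq' : (2 : ℚ) < q := by exact_mod_cast hq
  split_ifs with h
  · linarith
  · have : a.val ≠ 0 := fun h' => h ((ZMod.val_eq_zero a).1 h')
    exact_mod_cast Nat.one_le_iff_ne_zero.2 this

theorem letterWeight_one (hq : 2 < q) : letterWeight q 1 = 1 := by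
  have : Fact (1 < q) := ⟨by omega⟩
  simp [letterWeight, ZMod.val_one]

theorem pweight_neg [NeZero q] (N : ℕ) (u : Fin N → ZMod q) :
    pweight q N (-u) = N * q - pweight q N u := by
  simp [pweight_eq_sum, letterWeight_neg]

theorem pweight_comp_equiv (N : ℕ) (u : Fin N → ZMod q) (e : Equiv.Perm (Fin N)) :
    pweight q N (u ∘ e) = pweight q N u :=
  Equiv.sum_comp e fun i => letterWeight q (u i)

theorem pweight_update (N : ℕ) (u : Fin N → ZMod q) (i : Fin N) (x : ZMod q) :
    pweight q N (Function.update u i x) =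
      pweight q N u - letterWeight q (u i) + letterWeight q x := by
  rw [pweight_eq_sum, pweight_eq_sum, ← Finset.add_sum_erase _ _ (mem_univ i),
    ← Finset.add_sum_erase _ (fun j => letterWeight q (u j)) (mem_univ i),
    Finset.sum_congr rfl (g := fun j => letterWeight q (u j))
      fun j hj => by rw [Function.update_of_ne (Finset.ne_of_mem_erase hj)]]
  simp only [Function.update_self]
  ring

theorem pweight_const (N : ℕ) (a : ZMod q) :
    pweight q N (Function.const _ a) = N * letterWeight q a := by
  simp [pweight_eq_sum]

/-- Words whose pseudoweight is below half of the maximum. -/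
noncomputable def lightWords (q N : ℕ) [NeZero q] : Finset (Fin N → ZMod q) :=
  univ.filter fun u => 2 * pweight q N u < N * q

theorem mem_lightWords [NeZero q] {N : ℕ} {u : Fin N → ZMod q} :
    u ∈ lightWords q N ↔ 2 * pweight q N u < N * q := by simp [lightWords]

theorem two_mul_card_lightWords [NeZero q] (N : ℕ) :
    2 * (lightWords q N).card + rcount q N ((N : ℚ) * q / 2) = q ^ N := by
  classical
  have hneg : (lightWords q N).card =
      (univ.filter fun u : Fin N → ZMod q => (N : ℚ) * q < 2 * pweight q N u).card := by
    refine Finset.card_bij' (fun u _ => -u) (fun u _ => -u) ?_ ?_ (by simp) (by simp)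
    · intro u hu
      simp only [lightWords, mem_filter, mem_univ, true_and, pweight_neg] at hu ⊢
      linarith
    · intro u hu
      simp only [lightWords, mem_filter, mem_univ, true_and, pweight_neg] at hu ⊢
      linarith
  have hr : rcount q N ((N : ℚ) * q / 2) =
      (univ.filter fun u : Fin N → ZMod q => 2 * pweight q N u = N * q).card := by
    rw [rcount, Nat.card_eq_fintype_card, Fintype.card_subtype]
    congr 1
    ext u
    simp only [mem_filter, mem_univ, true_and]
    constructor <;> intro h <;> linarith
  have htot : (univ : Finset (Fin N → ZMod q)).card = q ^ N := by
    simp [ZMod.card]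
  rw [two_mul, ← htot]
  conv_lhs => enter [1, 2]; rw [hneg]
  rw [hr, lightWords, ← Finset.card_union_of_disjoint, ← Finset.card_union_of_disjoint]
  · congr 1
    ext u
    simp only [mem_union, mem_filter, mem_univ, true_and, iff_true]
    rcases lt_trichotomy (2 * pweight q N u) (N * q) with h | h | h <;> simp [h]
  · refine Finset.disjoint_left.2 fun u hu hu' => ?_
    simp only [mem_union, mem_filter, mem_univ, true_and] at hu hu'
    rcases hu with h | h <;> linarith
  · refine Finset.disjoint_left.2 fun u hu hu' => ?_
    simp only [mem_filter, mem_univ, true_and] at hu hu'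
    linarith

/-- The light words other than the constant words on the letters in `A`. -/
noncomputable def edgeWords (q N : ℕ) [NeZero q] (A : Finset (ZMod q)) :
    Finset (Fin N → ZMod q) :=
  lightWords q N \ A.image (Function.const _)

variable [NeZero q] {M : ℕ} {A : Finset (ZMod q)}

theorem image_const_subset_lightWords (hA : ∀ a ∈ A, a ≠ 0 ∧ 2 * a.val < q) :
    A.image (Function.const (Fin (M + 1))) ⊆ lightWords q (M + 1) := by
  intro u hu
  obtain ⟨a, ha, rfl⟩ := Finset.mem_image.1 hu
  obtain ⟨h0, h1⟩ := hA a ha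
  rw [mem_lightWords, pweight_const, letterWeight, if_neg h0]
  have h2 : (2 : ℚ) * a.val < q := by exact_mod_cast h1
  have h3 : (0 : ℚ) < ((M + 1 : ℕ) : ℚ) := by positivity
  nlinarith

theorem card_edgeWords_add (hA : ∀ a ∈ A, a ≠ 0 ∧ 2 * a.val < q) :
    (edgeWords q (M + 1) A).card + A.card = (lightWords q (M + 1)).card := by
  rw [edgeWords, ← Finset.card_sdiff_add_card_eq_card (image_const_subset_lightWords hA),
    Finset.card_image_of_injective _ Function.const_injective]

theorem sum_edgeWords (hA : ∀ a ∈ A, a ≠ 0 ∧ 2 * a.val < q) :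
    ∑ u ∈ edgeWords q (M + 1) A, u 0 = ∑ u ∈ lightWords q (M + 1), u 0 - ∑ a ∈ A, a := by
  rw [edgeWords, ← Finset.sum_sdiff (image_const_subset_lightWords hA),
    Finset.sum_image Function.const_injective.injOn]
  simp

theorem comp_equiv_mem_edgeWords_iff {N : ℕ} (e : Equiv.Perm (Fin N)) (u : Fin N → ZMod q) :
    u ∘ e ∈ edgeWords q N A ↔ u ∈ edgeWords q N A := by
  simp only [edgeWords, mem_sdiff, mem_lightWords, pweight_comp_equiv, Finset.mem_image]
  refine and_congr_right fun _ => not_congr (exists_congr fun a => and_congr_right fun _ => ?_)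
  constructor
  · intro h
    ext i
    simpa using congrFun h (e.symm i)
  · rintro rfl
    rfl

theorem mem_edgeWords_of_ne {N : ℕ} {u : Fin N → ZMod q} (h : 2 * pweight q N u < N * q)
    {i j : Fin N} (hij : u i ≠ u j) : u ∈ edgeWords q N A := by
  simp only [edgeWords, mem_sdiff, mem_lightWords, Finset.mem_image]
  refine ⟨h, ?_⟩
  rintro ⟨a, -, rfl⟩
  exact hij rfl

/-- The pure cycling register on edge words. -/
def rotateWords (q M : ℕ) [NeZero q] (A : Finset (ZMod q)) :
    Equiv.Perm {u // u ∈ edgeWords q (M + 1) A} :=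
  Equiv.Perm.subtypePerm ((finRotate (M + 1)).symm.arrowCongr (Equiv.refl (ZMod q)))
    fun u => comp_equiv_mem_edgeWords_iff (finRotate (M + 1)) u

theorem rotateWords_apply (u : {u // u ∈ edgeWords q (M + 1) A}) (k : Fin (M + 1)) :
    (rotateWords q M A u).1 k = u.1 (k + 1) := by
  rw [← finRotate_apply]
  rfl

theorem update_one_mem_edgeWords (hq : 2 < q) (hM : 0 < M) (i : Fin (M + 1)) :
    Function.update (1 : Fin (M + 1) → ZMod q) i 0 ∈ edgeWords q (M + 1) A := by
  have : Fact (1 < q) := ⟨by omega⟩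
  have : Nontrivial (Fin (M + 1)) := Fin.nontrivial_iff_two_le.2 (by omega)
  obtain ⟨j, hj⟩ := exists_ne i
  refine mem_edgeWords_of_ne (i := i) (j := j) ?_ (by simp [hj])
  have h1 : pweight q (M + 1) (1 : Fin (M + 1) → ZMod q) = (M + 1 : ℕ) := by
    have := pweight_const (M + 1) (1 : ZMod q)
    rwa [letterWeight_one hq, mul_one] at this
  rw [pweight_update, h1, Pi.one_apply, letterWeight_one hq, letterWeight, if_pos rfl]
  have hq' : (2 : ℚ) < q := by exact_mod_cast hq
  have hM' : (0 : ℚ) < M := by exact_mod_cast hM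
  push_cast
  nlinarith

theorem edgeWords_connected (hq : 2 < q) (hM : 0 < M)
    (O : Set {u // u ∈ edgeWords q (M + 1) A})
    (hz : ⟨_, update_one_mem_edgeWords hq hM 0⟩ ∈ O)
    (hrot : ∀ e ∈ O, rotateWords q M A e ∈ O)
    (htail : ∀ e ∈ O, ∀ e' : {u // u ∈ edgeWords q (M + 1) A},
      Fin.tail e'.1 = Fin.tail e.1 → e' ∈ O)
    (e : {u // u ∈ edgeWords q (M + 1) A}) : e ∈ O := by
  have hadd : ∀ (c : Fin (M + 1)) (e e' : {u // u ∈ edgeWords q (M + 1) A}), e ∈ O →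
      (∀ k, e'.1 k = e.1 (k + c)) → e' ∈ O := by
    intro c
    induction c using Fin.induction with
    | zero =>
      intro e e' he h
      rwa [show e' = e from Subtype.ext (funext fun k => by simpa using h k)]
    | succ c ih =>
      intro e e' he h
      refine ih _ e' (hrot e he) fun k => ?_
      rw [h, rotateWords_apply, add_assoc, Fin.coeSucc_eq_succ]
  have hshift : ∀ (c : Fin (M + 1)) (u : Fin (M + 1) → ZMod q), u ∈ edgeWords q (M + 1) A →
      (fun k => u (k + c)) ∈ edgeWords q (M + 1) A := fun c u hu =>
    (comp_equiv_mem_edgeWords_iff (Equiv.addRight c) u).2 hu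
  have hupd : ∀ (i : Fin (M + 1)) (e e' : {u // u ∈ edgeWords q (M + 1) A}), e ∈ O →
      (∀ j, j ≠ i → e'.1 j = e.1 j) → e' ∈ O := by
    intro i e e' he h
    refine hadd (-i) ⟨_, hshift i e'.1 e'.2⟩ e' ?_ (by simp)
    refine htail ⟨_, hshift i e.1 e.2⟩ (hadd i e _ he fun k => rfl) _ ?_
    ext k
    exact h _ fun hk => by simp at hk
  suffices H : ∀ (c : ℕ) (e : {u // u ∈ edgeWords q (M + 1) A}),
      (univ.filter fun i => e.1 i ≠ 1).card = c → e ∈ O from H _ e rfl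
  intro c
  induction c using Nat.strong_induction_on with
  | _ c ih =>
    intro e hc
    by_cases h : ∃ i, ∀ j, j ≠ i → e.1 j = 1
    · obtain ⟨i, hi⟩ := h
      refine hupd i ⟨_, update_one_mem_edgeWords hq hM i⟩ e ?_ fun j hj => by simp [hj, hi j hj]
      refine hadd (-i) _ _ hz fun k => ?_
      simp only [Function.update_apply, ← sub_eq_add_neg, sub_eq_zero, Pi.one_apply]
    · push Not at h
      obtain ⟨i, -, hi⟩ := h 0
      obtain ⟨j, hji, hj⟩ := h i
      have hmem : Function.update e.1 i 1 ∈ edgeWords q (M + 1) A := by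
        refine mem_edgeWords_of_ne (i := i) (j := j) ?_ ?_
        · have he := mem_lightWords.1 (Finset.mem_sdiff.1 e.2).1
          have := one_le_letterWeight hq (e.1 i)
          rw [pweight_update, letterWeight_one hq]
          linarith
        · simpa [hji] using hj.symm
      refine hupd i ⟨_, hmem⟩ e (ih _ ?_ _ rfl) fun j hj => by simp [hj]
      rw [← hc]
      refine Finset.card_lt_card (Finset.ssubset_iff_of_subset (fun k hk => ?_) |>.2 ⟨i, ?_, ?_⟩)
      · by_cases hki : k = i
        · simp [hki] at hk
        · simpa [hki] using hk
      · simpa using hi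
      · simp

/-- A cyclic sequence whose windows run through the edge words exactly once per period. -/
theorem exists_edgeWords_circuit (hq : 2 < q) (hM : 0 < M) :
    ∃ T : ℤ → ZMod q,
      (∀ i, (fun k : Fin (M + 1) => T (i + (k : ℕ))) ∈ edgeWords q (M + 1) A) ∧
      (∀ i j, (∀ k : Fin (M + 1), T (i + (k : ℕ)) = T (j + (k : ℕ))) ↔
        ((edgeWords q (M + 1) A).card : ℤ) ∣ i - j) ∧
      ∑ i ∈ range (edgeWords q (M + 1) A).card, T i = ∑ u ∈ edgeWords q (M + 1) A, u 0 := by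
  classical
  set z : {u // u ∈ edgeWords q (M + 1) A} := ⟨_, update_one_mem_edgeWords hq hM 0⟩
  obtain ⟨σ, hσ, hcyc⟩ := exists_perm_sameCycle
    (fun e : {u // u ∈ edgeWords q (M + 1) A} => Fin.tail e.1) (rotateWords q M A) z
    (fun O h1 h2 h3 e => edgeWords_connected hq hM O h1 h2 h3 e)
  have hstep : ∀ e (k : Fin M), (σ e).1 k.castSucc = e.1 k.succ := by
    intro e k
    have h1 : (σ e).1 k.castSucc = ((rotateWords q M A)⁻¹ (σ e)).1 (k.castSucc + 1) := by
      rw [← rotateWords_apply]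
      simp
    rw [h1, Fin.coeSucc_eq_succ]
    exact congrFun (hσ e) k
  have hon : σ.IsCycleOn (univ : Finset {u // u ∈ edgeWords q (M + 1) A}) :=
    ⟨by rw [Finset.coe_univ]; exact Set.bijOn_univ.2 σ.bijective, fun x _ y _ => (hcyc x).symm.trans (hcyc y)⟩
  have hcard : (univ : Finset {u // u ∈ edgeWords q (M + 1) A}).card =
      (edgeWords q (M + 1) A).card := by simp
  have hwin : ∀ (k : ℕ) (hk : k < M + 1) (i : ℤ),
      (((σ ^ (i + k)) z).1 0) = ((σ ^ i) z).1 ⟨k, hk⟩ := by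
    intro k
    induction k with
    | zero => intro hk i; simp
    | succ k ih =>
      intro hk i
      have h := ih (by omega) (i + 1)
      rw [add_assoc, add_comm (1 : ℤ) k] at h
      push_cast
      rw [h, add_comm i 1, zpow_one_add, mul_apply]
      exact hstep _ ⟨k, by omega⟩
  refine ⟨fun i => ((σ ^ i) z).1 0, fun i => ?_, fun i j => ?_, ?_⟩
  · have : (fun k : Fin (M + 1) => ((σ ^ (i + (k : ℕ))) z).1 0) = ((σ ^ i) z).1 :=
      funext fun k => hwin k k.2 i
    rw [this]
    exact ((σ ^ i) z).2
  · rw [← hcard, ← hon.zpow_apply_eq (mem_univ z)]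
    have h1 : (∀ k : Fin (M + 1), ((σ ^ (i + (k : ℕ))) z).1 0 = ((σ ^ (j + (k : ℕ))) z).1 0) ↔
        (σ ^ i) z = (σ ^ j) z := by
      rw [Subtype.ext_iff, funext_iff]
      exact forall_congr' fun k => by rw [hwin k k.2, hwin k k.2]
    refine h1.trans ?_
    rw [sub_eq_neg_add, zpow_add, mul_apply, zpow_neg, inv_eq_iff_eq]
  · rw [← Finset.sum_coe_sort (edgeWords q (M + 1) A)]
    rw [← hcard]
    refine Finset.sum_bij (fun (i : ℕ) _ => (σ ^ i) z) (fun _ _ => mem_univ _) ?_ ?_ ?_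
    · intro i hi j hj hij
      exact hon.pow_apply_eq_pow_apply (mem_univ z) |>.1 hij |>.eq_of_lt_of_lt
        (Finset.mem_range.1 hi) (Finset.mem_range.1 hj)
    · intro e _
      obtain ⟨i, hi, rfl⟩ := hon.exists_pow_eq (mem_univ z) (mem_univ e)
      exact ⟨i, Finset.mem_range.2 hi, rfl⟩
    · intro i _
      simp

end Weight

/-- If the first differences of `S` run through the edge words and have invertible sum over a
period, then `S` is an orientable sequence. -/
theorem exists_isOS_of_isUnit {q M : ℕ} [NeZero q] (hq : 2 < q) (hM : 0 < M)
    {A : Finset (ZMod q)} (hunit : IsUnit (∑ u ∈ edgeWords q (M + 1) A, u 0)) :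
    ∃ S : ℤ → ZMod q, IsOS q (M + 2) (q * (edgeWords q (M + 1) A).card) S := by
  obtain ⟨T, hT, hper, hsum⟩ := exists_edgeWords_circuit (A := A) hq hM
  obtain ⟨S, hS⟩ := exists_int_antidifference T
  rw [← hsum] at hunit
  have hpos : 0 < (edgeWords q (M + 1) A).card := Finset.card_pos.2 ⟨_, hT 0⟩
  generalize (edgeWords q (M + 1) A).card = m at *
  have hTper : ∀ i, T (i + m) = T i := fun i => by
    simpa using (hper (i + m) i).2 (by simp) 0
  have hnat : ∀ k : ℕ, S k = S 0 + ∑ i ∈ range k, T i := by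
    intro k
    induction k with
    | zero => simp
    | succ k ih => rw [Finset.sum_range_succ, Nat.cast_succ, hS, ih, add_assoc]
  have hSm : ∀ i : ℤ, S (i + m) = S i + ∑ i ∈ range m, T i := by
    intro i
    have hs : ∀ i : ℤ, S (i + 1 + m) - S (i + 1) = S (i + m) - S i := fun i => by
      rw [add_right_comm, hS, hS, hTper]
      ring
    suffices h : S (i + m) - S i = ∑ i ∈ range m, T i by rw [← h]; ring
    induction i using Int.induction_on with
    | zero => rw [zero_add, hnat]; ring
    | succ i ih => rw [hs, ih]
    | pred i ih =>
      rw [← hs, sub_add_cancel]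
      exact ih
  have hSmul : ∀ t i : ℤ, S (i + m * t) = S i + t * ∑ i ∈ range m, T i := by
    intro t
    induction t using Int.induction_on with
    | zero => simp
    | succ t ih =>
      intro i
      rw [mul_add, mul_one, ← add_assoc, hSm, ih]
      push_cast
      ring
    | pred t ih =>
      intro i
      have h := hSm (i + m * (-(t : ℤ) - 1))
      rw [show i + m * (-(t : ℤ) - 1) + m = i + m * -(t : ℤ) by ring, ih] at h
      rw [← sub_eq_iff_eq_add.2 h]
      push_cast
      ring
  refine ⟨S, ⟨by omega, by omega, by positivity, fun i => ?_, fun i j hij => ?_⟩,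
    fun i j hij => ?_⟩
  · have := hSmul q i
    rw [show ((q * m : ℕ) : ℤ) = m * q by push_cast; ring, this]
    simp
  · have hw : ∀ k : ℕ, k < M + 2 → S (i + k) = S (j + k) := fun k hk =>
      congrFun hij ⟨k, hk⟩
    have hdvd := (hper i j).1 fun k => by
      have h1 := hw k (by omega)
      have h2 := hw (k + 1) (by omega)
      push_cast at h2
      rw [← add_assoc, ← add_assoc, hS, hS, h1] at h2
      exact add_left_cancel h2
    obtain ⟨t, ht⟩ := hdvd
    have h0 := hw 0 (by omega)
    simp only [Nat.cast_zero, add_zero] at h0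
    have h1 := hSmul t j
    rw [← ht, add_sub_cancel, h0] at h1
    have h2 : (t : ZMod q) * ∑ i ∈ range m, T i = 0 := by simpa using h1.symm
    have h3 : (q : ℤ) ∣ t := (ZMod.intCast_zmod_eq_zero_iff_dvd t q).1
      (hunit.mul_left_eq_zero.1 h2)
    rw [ht]
    push_cast
    rw [mul_comm (q : ℤ)]
    exact mul_dvd_mul_left _ h3
  · have hw : ∀ k : ℕ, k < M + 2 → S (i + k) = S (j + (M + 1 - k : ℕ)) := fun k hk => by
      have := congrFun hij ⟨k, hk⟩
      simp only [window, Function.comp_apply, Fin.val_rev] at this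
      rw [this]
      congr 3
      omega
    have hneg : (fun k : Fin (M + 1) => T (i + (k : ℕ))) =
        (-fun k : Fin (M + 1) => T (j + (k : ℕ))) ∘ Fin.revPerm := by
      ext k
      have h1 := hw k (by omega)
      have h2 := hw (k + 1) (by omega)
      have h3 := hS (i + k)
      have h4 := hS (j + (M - k : ℕ))
      rw [show j + ((M - k : ℕ) : ℤ) + 1 = j + (M + 1 - k : ℕ) by omega] at h4
      rw [show M + 1 - (k + 1 : ℕ) = M - k by omega] at h2
      push_cast at h2
      rw [← add_assoc] at h2
      simp only [Function.comp_apply, Pi.neg_apply, Fin.revPerm_apply, Fin.val_rev]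
      rw [show M + 1 - (k + 1 : ℕ) = M - k by omega]
      linear_combination h2 - h1 - h3 - h4
    have h1 := mem_lightWords.1 (Finset.mem_sdiff.1 (hT i)).1
    have h2 := mem_lightWords.1 (Finset.mem_sdiff.1 (hT j)).1
    rw [hneg, pweight_comp_equiv, pweight_neg] at h1
    linarith

end OrientableSeq

/-- existence of an `OS_q(n)` of large period, for `n > 2`, `q > 2`. -/
theorem stmt19 (q n : ℕ) (hq : 2 < q) (hn : 2 < n) :
    ∃ (m : ℕ) (S : ℤ → ZMod q), IsOS q n m S ∧
      (if q ≠ 6 then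
        (q : ℚ) * ((q : ℚ) ^ (n - 1) -
          rcount q (n - 1) (((n : ℚ) - 1) * q / 2) - 2) / 2
       else
        (q : ℚ) * ((q : ℚ) ^ (n - 1) -
          rcount q (n - 1) (((n : ℚ) - 1) * q / 2) - 4) / 2) ≤ (m : ℚ) := by
  have : NeZero q := ⟨by omega⟩
  obtain ⟨M, rfl⟩ : ∃ M, n = M + 2 := ⟨n - 2, by omega⟩
  obtain ⟨A, hA, hcard, hunit⟩ :=
    OrientableSeq.exists_finset_isUnit_sub_sum hq
      (∑ u ∈ OrientableSeq.lightWords q (M + 1), u 0)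
  rw [← OrientableSeq.sum_edgeWords hA] at hunit
  obtain ⟨S, hS⟩ := OrientableSeq.exists_isOS_of_isUnit hq (by omega) hunit
  refine ⟨_, S, hS, ?_⟩
  have h1 := OrientableSeq.two_mul_card_lightWords (q := q) (M + 1)
  rw [← OrientableSeq.card_edgeWords_add hA] at h1
  have h2 : (2 : ℚ) * ((OrientableSeq.edgeWords q (M + 1) A).card + A.card) +
      rcount q (M + 1) (((M + 1 : ℕ) : ℚ) * q / 2) = (q : ℚ) ^ (M + 1) := by
    exact_mod_cast h1
  have hs : (((M + 2 : ℕ) : ℚ) - 1) * q / 2 = ((M + 1 : ℕ) : ℚ) * q / 2 := by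
    push_cast
    ring
  rw [hs, show M + 2 - 1 = M + 1 by omega, ← h2]
  have hq0 : (0 : ℚ) ≤ q := by positivity
  push_cast
  split_ifs at hcard ⊢ with h6
  · have h3 : (A.card : ℚ) ≤ 1 := by exact_mod_cast hcard
    nlinarith
  · have h3 : (A.card : ℚ) ≤ 2 := by exact_mod_cast hcard
    nlinarith
end
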